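/- arXiv:1306.0616 — 2 statements merged into one kernel-verified Lean document; each statement's English description precedes it below -/
import Mathlib

section
/- Let β be a real number with 0 < β < 1, and define g : ℝ → ℝ near 0 by g(t) = log(1 − β(1 − e^t)). Then the third derivative of g at t = 0 equals β(1 − 3β + 2β²), and the fourth derivative of g at t = 0 equals β(1 − 7β + 12β² − 6β³). -/
theorem one_sub_mul_one_sub_exp_pos {β : ℝ} (hβ0 : 0 < β) (hβ1 : β < 1) (t : ℝ) :
    0 < 1 - β * (1 - Real.exp t) := by
  nlinarith [mul_pos hβ0 (Real.exp_pos t)]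

theorem hasDerivAt_one_sub_mul_one_sub_exp (β t : ℝ) :
    HasDerivAt (fun t : ℝ => 1 - β * (1 - Real.exp t)) (β * Real.exp t) t := by
  simpa using (((Real.hasDerivAt_exp t).const_sub 1).const_mul β).const_sub 1

/-- The logistic function `u = β e^t / (1 - β(1 - e^t))` satisfies `u' = u - u²`. -/
theorem hasDerivAt_logistic {β : ℝ} (hβ0 : 0 < β) (hβ1 : β < 1) (t : ℝ) :
    HasDerivAt (fun t : ℝ => β * Real.exp t / (1 - β * (1 - Real.exp t)))
      (β * Real.exp t / (1 - β * (1 - Real.exp t)) -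
        (β * Real.exp t / (1 - β * (1 - Real.exp t))) ^ 2) t := by
  have hne := (one_sub_mul_one_sub_exp_pos hβ0 hβ1 t).ne'
  refine (((Real.hasDerivAt_exp t).const_mul β).fun_div
    (hasDerivAt_one_sub_mul_one_sub_exp β t) hne).congr_deriv ?_
  field_simp


/-- Vertex corrections: for `0 < β < 1` and `g(t) = log(1 - β(1 - e^t))`, the third
derivative of `g` at `0` is `β(1 - 3β + 2β²) = β f₃(β)` and the fourth derivative
of `g` at `0` is `β(1 - 7β + 12β² - 6β³) = β f₄(β)`. -/
theorem vertex_correction_derivatives (β : ℝ) (hβ0 : 0 < β) (hβ1 : β < 1) :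
    iteratedDeriv 3 (fun t : ℝ => Real.log (1 - β * (1 - Real.exp t))) 0 =
      β * (1 - 3 * β + 2 * β ^ 2) ∧
    iteratedDeriv 4 (fun t : ℝ => Real.log (1 - β * (1 - Real.exp t))) 0 =
      β * (1 - 7 * β + 12 * β ^ 2 - 6 * β ^ 3) := by
  set u : ℝ → ℝ := fun t => β * Real.exp t / (1 - β * (1 - Real.exp t)) with hu
  have hu' (t : ℝ) : HasDerivAt u (u t - u t ^ 2) t := hasDerivAt_logistic hβ0 hβ1 t
  have hu0 : u 0 = β := by simp [hu]
  have h1 : deriv (fun t : ℝ => Real.log (1 - β * (1 - Real.exp t))) = u :=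
    funext fun t => ((hasDerivAt_one_sub_mul_one_sub_exp β t).log
      (one_sub_mul_one_sub_exp_pos hβ0 hβ1 t).ne').deriv
  have h2 : deriv u = fun t => u t - u t ^ 2 := funext fun t => (hu' t).deriv
  have h3 : deriv (fun t => u t - u t ^ 2) = fun t => u t - 3 * u t ^ 2 + 2 * u t ^ 3 := by
    funext t
    rw [((hu' t).fun_sub ((hu' t).fun_pow 2)).deriv]
    norm_num
    ring
  have h4 : deriv (fun t => u t - 3 * u t ^ 2 + 2 * u t ^ 3) =
      fun t => u t - 7 * u t ^ 2 + 12 * u t ^ 3 - 6 * u t ^ 4 := by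
    funext t
    rw [(((hu' t).fun_sub (((hu' t).fun_pow 2).const_mul 3)).fun_add
      (((hu' t).fun_pow 3).const_mul 2)).deriv]
    norm_num
    ring
  simp only [iteratedDeriv_succ', iteratedDeriv_zero, h1, h2, h3, h4, hu0]
  constructor <;> ring
end

section
/- Let 𝒩₂(N) denote the number of subsets S of {1,…,N²} with |S| = N and Σ_{i∈S} i = N(N²+1)/2. Then, as N → ∞, 𝒩₂(N) = (1/π)·√(3/e) · (N·e)^N / N³ · (1 + 3/(5N) + 31/(420N²) + O(1/N³)); equivalently, π·√(e/3)·N³·(N·e)^{−N}·𝒩₂(N) − (1 + 3/(5N) + 31/(420N²)) = O(1/N³). -/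
open Filter Asymptotics

/-- The number of magic square series of order `N`: subsets of `{1,…,N²}` with `N`
elements summing to the magic constant `N(N²+1)/2`. -/
def magicSquareSeries (N : ℕ) : ℕ :=
  ((Finset.Icc 1 (N ^ 2)).powerset.filter
    (fun S => S.card = N ∧ ∑ i ∈ S, i = N * (N ^ 2 + 1) / 2)).card

/-- The generating polynomial, evaluated at `q`, of the sums of the `N`-element subsets of
`{1,…,M}`. -/
noncomputable def subsetSumGF (M N : ℕ) (q : ℂ) : ℂ :=
  ∑ S ∈ (Finset.Icc 1 M).powersetCard N, q ^ ∑ i ∈ S, i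

lemma subsetSumGF_zero (M : ℕ) (q : ℂ) : subsetSumGF M 0 q = 1 := by
  simp [subsetSumGF]

lemma subsetSumGF_zero_succ (N : ℕ) (q : ℂ) : subsetSumGF 0 (N + 1) q = 0 := by
  rw [subsetSumGF, Finset.powersetCard_eq_empty.2 (by simp), Finset.sum_empty]

lemma subsetSumGF_succ_succ (M N : ℕ) (q : ℂ) :
    subsetSumGF (M + 1) (N + 1) q = subsetSumGF M (N + 1) q + q ^ (M + 1) * subsetSumGF M N q := by
  have hM : M + 1 ∉ Finset.Icc 1 M := by simp
  unfold subsetSumGF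
  rw [← Finset.insert_Icc_right_eq_Icc_add_one (by omega), Finset.powersetCard_succ_insert hM,
    Finset.sum_union, Finset.sum_image, Finset.mul_sum]
  · congr 1
    refine Finset.sum_congr rfl fun S hS => ?_
    have hS' : M + 1 ∉ S := fun h => hM ((Finset.mem_powersetCard.1 hS).1 h)
    rw [Finset.sum_insert hS', pow_add]
  · intro S hS T hT h
    have hS' : M + 1 ∉ S := fun h => hM ((Finset.mem_powersetCard.1 hS).1 h)
    have hT' : M + 1 ∉ T := fun h => hM ((Finset.mem_powersetCard.1 hT).1 h)
    rw [← Finset.erase_insert hS', ← Finset.erase_insert hT']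
    exact congrArg (fun U => U.erase (M + 1)) h
  · rw [Finset.disjoint_left]
    intro S hS hS'
    obtain ⟨T, -, rfl⟩ := Finset.mem_image.1 hS'
    exact hM ((Finset.mem_powersetCard.1 hS).1 (Finset.mem_insert_self _ _))

lemma subsetSumGF_mul_prod (M N : ℕ) (q : ℂ) :
    subsetSumGF M N q * ∏ j ∈ Finset.range N, (1 - q ^ (j + 1)) =
      q ^ (∑ j ∈ Finset.range N, (j + 1)) * ∏ i ∈ Finset.range N, (1 - q ^ (M - i)) := by
  induction M generalizing N with
  | zero =>
    cases N with
    | zero => simp [subsetSumGF_zero]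
    | succ N => simp [subsetSumGF_zero_succ]
  | succ M ih =>
    cases N with
    | zero => simp [subsetSumGF_zero]
    | succ N =>
      have h1 := ih (N + 1)
      have h2 := ih N
      rw [subsetSumGF_succ_succ, add_mul, h1, Finset.prod_range_succ (fun j => 1 - q ^ (j + 1)),
        Finset.prod_range_succ (fun i => 1 - q ^ (M - i)),
        Finset.prod_range_succ' (fun i => 1 - q ^ (M + 1 - i)), Finset.sum_range_succ]
      simp only [Nat.add_sub_add_right, Nat.sub_zero]
      rcases le_or_gt N M with h | h
      · have h3 : q ^ (N + 1) * (1 - q ^ (M - N)) = q ^ (N + 1) - q ^ (M + 1) := by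
          rw [mul_sub, mul_one, ← pow_add]
          congr 2
          omega
        rw [pow_add]
        linear_combination (q ^ (M + 1) * (1 - q ^ (N + 1))) * h2 +
          q ^ (∑ x ∈ Finset.range N, (x + 1)) * (∏ x ∈ Finset.range N, (1 - q ^ (M - x))) * h3
      · have h0 : ∏ x ∈ Finset.range N, (1 - q ^ (M - x)) = 0 :=
          Finset.prod_eq_zero (Finset.mem_range.2 h) (by simp)
        rw [h0] at h2 ⊢
        linear_combination (q ^ (M + 1) * (1 - q ^ (N + 1))) * h2

open Complex in
lemma one_sub_exp_mul_I (k : ℕ) (x : ℝ) :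
    1 - exp (2 * x * I) ^ k = -2 * I * exp (x * I) ^ k * (Real.sin (k * x) : ℂ) := by
  have h : exp (2 * x * I) ^ k = exp (k * x * I) * exp (k * x * I) := by
    rw [← exp_nat_mul, ← exp_add]
    congr 1
    ring
  have h' : exp (x * I) ^ k = exp (k * x * I) := by
    rw [← exp_nat_mul]
    congr 1
    ring
  have hs : exp (k * x * I) * exp (-(k * x * I)) = 1 := by rw [← exp_add]; simp
  rw [h, h']
  push_cast
  rw [sin]
  have : (-(k * x : ℂ) * I) = -(k * x * I) := by ring
  rw [this]
  linear_combination (exp (k * x * I) * exp (-(k * x * I)) - exp (k * x * I) ^ 2) * I_sq - hs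

open Complex in
lemma subsetSumGF_exp_mul_prod_sin {M N : ℕ} (h : N ≤ M) (x : ℝ) :
    subsetSumGF M N (exp (2 * x * I)) * ∏ j ∈ Finset.range N, (Real.sin ((j + 1) * x) : ℂ) =
      exp (x * I) ^ (N * (M + 1)) * ∏ i ∈ Finset.range N, (Real.sin ((M - i) * x) : ℂ) := by
  have key := subsetSumGF_mul_prod M N (exp (2 * x * I))
  simp only [one_sub_exp_mul_I, Finset.prod_mul_distrib, Finset.prod_pow_eq_pow_sum,
    Finset.prod_const] at key
  have hE : exp (x * I) ≠ 0 := exp_ne_zero _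
  have hc : (-2 * I) ^ (Finset.range N).card ≠ 0 := pow_ne_zero _ (by simp)
  have hsum : ∑ j ∈ Finset.range N, (j + 1) + ∑ i ∈ Finset.range N, (M - i) = N * (M + 1) := by
    rw [← Finset.sum_add_distrib, Finset.sum_congr rfl (g := fun _ => M + 1)]
    · simp
    · intro i hi
      have := Finset.mem_range.1 hi
      omega
  have h2 : exp (2 * x * I) = exp (x * I) ^ 2 := by
    rw [← exp_nat_mul]; congr 1; push_cast; ring
  have e1 : ∏ i ∈ Finset.range N, (Real.sin (((M - i : ℕ) : ℝ) * x) : ℂ) =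
      ∏ i ∈ Finset.range N, (Real.sin ((M - i) * x) : ℂ) := by
    refine Finset.prod_congr rfl fun i hi => ?_
    rw [Nat.cast_sub ((Finset.mem_range.1 hi).le.trans h)]
  rw [e1] at key
  push_cast at key ⊢
  have hT : exp (x * I) ^ (∑ j ∈ Finset.range N, (j + 1)) ≠ 0 := pow_ne_zero _ hE
  refine mul_left_cancel₀ (mul_ne_zero hc hT) ?_
  have h4 : exp (2 * x * I) ^ (∑ j ∈ Finset.range N, (j + 1)) =
      exp (x * I) ^ (∑ j ∈ Finset.range N, (j + 1)) * exp (x * I) ^ (∑ j ∈ Finset.range N, (j + 1)) := by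
    rw [h2, ← pow_mul, ← pow_add]; congr 1; ring
  rw [← hsum, pow_add]
  linear_combination key + (exp (x * I) ^ (∑ i ∈ Finset.range N, (M - i)) * (-2 * I) ^ (Finset.range N).card * ∏ i ∈ Finset.range N, sin ((M - i) * x)) * h4

lemma two_mul_half_magic (N : ℕ) : 2 * (N * (N ^ 2 + 1) / 2) = N * (N ^ 2 + 1) := by
  apply Nat.mul_div_cancel'
  rcases Nat.even_or_odd N with h | h
  · exact h.two_dvd.mul_right _
  · exact (h.pow.add_odd odd_one).two_dvd.mul_left _

/-- The real part of the generating function of the subset sums, centred at the magic constant. -/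
noncomputable def magicKernel (N : ℕ) (θ : ℝ) : ℝ :=
  ∑ S ∈ (Finset.Icc 1 (N ^ 2)).powersetCard N,
    Real.cos ((((∑ i ∈ S, i : ℕ) : ℤ) - ((N * (N ^ 2 + 1) / 2 : ℕ) : ℤ) : ℤ) * θ)

lemma integral_cos_int_mul (k : ℤ) :
    ∫ θ in (0 : ℝ)..Real.pi, Real.cos (k * θ) = if k = 0 then Real.pi else 0 := by
  split_ifs with h
  · simp [h]
  · have h' : (k : ℝ) ≠ 0 := by exact_mod_cast h
    rw [intervalIntegral.integral_comp_mul_left _ h']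
    simp

lemma continuous_magicKernel (N : ℕ) : Continuous (magicKernel N) := by
  unfold magicKernel
  fun_prop

lemma integral_magicKernel (N : ℕ) :
    ∫ θ in (0 : ℝ)..Real.pi, magicKernel N θ = Real.pi * magicSquareSeries N := by
  unfold magicKernel
  rw [intervalIntegral.integral_finsetSum]
  · simp only [integral_cos_int_mul]
    rw [← Finset.sum_filter, Finset.sum_const, nsmul_eq_mul, mul_comm, magicSquareSeries]
    congr 3
    ext S
    simp only [Finset.mem_filter, Finset.mem_powersetCard, Finset.mem_powerset, sub_eq_zero,
      Nat.cast_inj]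
    tauto
  · intro S _
    exact (by fun_prop : Continuous _).intervalIntegrable _ _

open Complex in
lemma magicKernel_eq_re (N : ℕ) (x : ℝ) :
    (magicKernel N (2 * x)) =
      (exp (-(x * I)) ^ (N * (N ^ 2 + 1)) * subsetSumGF (N ^ 2) N (exp (2 * x * I))).re := by
  unfold magicKernel subsetSumGF
  rw [Finset.mul_sum, re_sum]
  refine Finset.sum_congr rfl fun S _ => ?_
  rw [← exp_nat_mul, ← exp_nat_mul, ← exp_add, ← exp_ofReal_mul_I_re]
  congr 2
  have := two_mul_half_magic N
  have h : ((N * (N ^ 2 + 1) : ℕ) : ℂ) = 2 * ((N * (N ^ 2 + 1) / 2 : ℕ) : ℂ) := by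
    exact_mod_cast this.symm
  rw [h]
  generalize N * (N ^ 2 + 1) / 2 = m
  push_cast
  ring

lemma abs_magicKernel_le (N : ℕ) (θ : ℝ) :
    |magicKernel N θ| ≤ ‖subsetSumGF (N ^ 2) N (Complex.exp (θ * Complex.I))‖ := by
  have h := magicKernel_eq_re N (θ / 2)
  rw [mul_div_cancel₀ θ two_ne_zero] at h
  rw [h]
  refine (Complex.abs_re_le_norm _).trans ?_
  have h1 : ‖Complex.exp (-(((θ / 2 : ℝ) : ℂ) * Complex.I))‖ = 1 := by
    rw [← neg_mul, ← Complex.ofReal_neg, Complex.norm_exp_ofReal_mul_I]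
  have h2 : (2 * ((θ / 2 : ℝ) : ℂ)) = θ := by push_cast; ring
  rw [norm_mul, norm_pow, h1, one_pow, one_mul, h2]

lemma magicKernel_mul_prod_sin (N : ℕ) (x : ℝ) :
    magicKernel N (2 * x) * ∏ j ∈ Finset.range N, Real.sin ((j + 1) * x) =
      ∏ i ∈ Finset.range N, Real.sin (((N : ℝ) ^ 2 - i) * x) := by
  rw [magicKernel_eq_re, ← Complex.re_mul_ofReal, Complex.ofReal_prod, mul_assoc,
    subsetSumGF_exp_mul_prod_sin (Nat.le_self_pow two_ne_zero N), ← mul_assoc, ← mul_pow,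
    ← Complex.exp_add, neg_add_cancel, Complex.exp_zero, one_pow, one_mul, ← Complex.ofReal_prod,
    Complex.ofReal_re]
  push_cast
  rfl

open Polynomial in
lemma Polynomial.norm_coeff_le_of_forall_norm_eval_le (p : ℂ[X]) (n : ℕ) {B : ℝ} (hB0 : 0 ≤ B)
    (hB : ∀ z : ℂ, ‖z‖ = 1 → ‖p.eval z‖ ≤ B) : ‖p.coeff n‖ ≤ B := by
  by_cases hn : n ∈ p.support
  · refine le_of_sq_le_sq ?_ hB0
    calc ‖p.coeff n‖ ^ 2 ≤ ∑ i ∈ p.support, ‖p.coeff i‖ ^ 2 :=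
          Finset.single_le_sum (f := fun i => ‖p.coeff i‖ ^ 2) (fun i _ => sq_nonneg _) hn
      _ = _ := p.sum_sq_norm_coeff_eq_circleAverage
      _ ≤ B ^ 2 := by
        refine Real.circleAverage_mono_on_of_le_circle ?_ fun z hz => ?_
        · exact ContinuousOn.circleIntegrable' (by fun_prop)
        · have hz' : ‖z‖ = 1 := by simpa using hz
          exact pow_le_pow_left₀ (norm_nonneg _) (hB z hz') 2
  · rw [Polynomial.notMem_support_iff.1 hn, norm_zero]
    exact hB0

lemma norm_add_le_exp {z w : ℂ} (hz : ‖z‖ = 1) {r : ℝ} (hw : ‖w‖ = 1) :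
    ‖z + r * w‖ ≤ Real.exp (r * (w * star z).re + r ^ 2 / 2) := by
  have h : ‖z + r * w‖ ^ 2 = 1 + 2 * (r * (w * star z).re) + r ^ 2 := by
    rw [← Complex.normSq_eq_norm_sq, Complex.normSq_add, Complex.normSq_eq_norm_sq, hz]
    simp [Complex.normSq_eq_norm_sq, hw]
    ring
  refine le_of_sq_le_sq ?_ (Real.exp_pos _).le
  rw [h, ← Real.exp_nat_mul]
  have := Real.add_one_le_exp (2 * (r * (w * star z).re) + r ^ 2)
  have e : ((2 : ℕ) : ℝ) * (r * (w * star z).re + r ^ 2 / 2) = 2 * (r * (w * star z).re) + r ^ 2 := by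
    push_cast; ring
  rw [e]
  linarith

lemma norm_subsetSumGF_le {M N : ℕ} (hMN : N ≤ M) {r : ℝ} (hr : 0 < r) {q : ℂ} (hq : ‖q‖ = 1) :
    ‖subsetSumGF M N q‖ ≤
      (r ^ N)⁻¹ * Real.exp (r * ‖∑ k ∈ Finset.Icc 1 M, q ^ k‖ + M * r ^ 2 / 2) := by
  set p : Polynomial ℂ := ∏ k ∈ Finset.Icc 1 M, (Polynomial.X + Polynomial.C (r * q ^ k)) with hp
  have hc : p.coeff (M - N) = r ^ N * subsetSumGF M N q := by
    rw [hp, Finset.prod_X_add_C_coeff _ _ (by simp), subsetSumGF, Finset.mul_sum]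
    have : (Finset.Icc 1 M).card - (M - N) = N := by simp; omega
    rw [this]
    refine Finset.sum_congr rfl fun S hS => ?_
    rw [Finset.prod_mul_distrib, Finset.prod_const, (Finset.mem_powersetCard.1 hS).2,
      Finset.prod_pow_eq_pow_sum]
  have hb : ‖p.coeff (M - N)‖ ≤
      Real.exp (r * ‖∑ k ∈ Finset.Icc 1 M, q ^ k‖ + M * r ^ 2 / 2) := by
    refine p.norm_coeff_le_of_forall_norm_eval_le _ (Real.exp_pos _).le fun z hz => ?_
    rw [hp, Polynomial.eval_prod, norm_prod]
    calc ∏ k ∈ Finset.Icc 1 M, ‖Polynomial.eval z (Polynomial.X + Polynomial.C (r * q ^ k))‖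
        ≤ ∏ k ∈ Finset.Icc 1 M, Real.exp (r * (q ^ k * star z).re + r ^ 2 / 2) := by
          refine Finset.prod_le_prod (fun _ _ => norm_nonneg _) fun k _ => ?_
          simpa using norm_add_le_exp hz (r := r) (w := q ^ k) (by rw [norm_pow, hq, one_pow])
      _ = Real.exp (r * ((∑ k ∈ Finset.Icc 1 M, q ^ k) * star z).re + M * r ^ 2 / 2) := by
          rw [← Real.exp_sum, Finset.sum_add_distrib, ← Finset.mul_sum, Finset.sum_mul,
            Complex.re_sum]
          simp
          ring
      _ ≤ _ := by
          gcongr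
          refine (Complex.re_le_norm _).trans ?_
          rw [norm_mul, norm_star, hz, mul_one]
  rw [hc, norm_mul, norm_pow, Complex.norm_real, Real.norm_of_nonneg hr.le] at hb
  rwa [← div_eq_inv_mul, le_div_iff₀' (by positivity)]

lemma norm_geom_sum_exp_mul (M : ℕ) (x : ℝ) :
    ‖∑ k ∈ Finset.Icc 1 M, Complex.exp (2 * x * Complex.I) ^ k‖ * |Real.sin x| = |Real.sin (M * x)| := by
  have hI : ∀ (k : ℕ), ‖1 - Complex.exp (2 * x * Complex.I) ^ k‖ = 2 * |Real.sin (k * x)| := by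
    intro k
    have h : Complex.exp (x * Complex.I) ^ k = Complex.exp (((k * x : ℝ) : ℂ) * Complex.I) := by
      rw [← Complex.exp_nat_mul]; push_cast; ring_nf
    rw [one_sub_exp_mul_I, h, norm_mul, Complex.norm_real, norm_mul, Complex.norm_exp_ofReal_mul_I]
    simp
  have h1 : ‖Complex.exp (2 * x * Complex.I)‖ = 1 := by
    have : (2 * x * Complex.I) = ((2 * x : ℝ) : ℂ) * Complex.I := by push_cast; ring
    rw [this, Complex.norm_exp_ofReal_mul_I]
  have hs : ∑ k ∈ Finset.Icc 1 M, Complex.exp (2 * x * Complex.I) ^ k =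
      Complex.exp (2 * x * Complex.I) * ∑ k ∈ Finset.range M, Complex.exp (2 * x * Complex.I) ^ k := by
    rw [Finset.mul_sum, Finset.range_eq_Ico, Finset.sum_congr rfl (fun k _ => (pow_succ' _ k).symm),
      Finset.sum_Ico_add' (fun k => Complex.exp (2 * x * Complex.I) ^ k) 0 M 1]
    rfl
  have h2 := congrArg norm (mul_neg_geom_sum (Complex.exp (2 * x * Complex.I)) M)
  have h3 := hI 1
  rw [norm_mul, hI M] at h2
  rw [pow_one, Nat.cast_one, one_mul] at h3
  rw [h3] at h2
  rw [hs, norm_mul, h1]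
  linarith

lemma abs_sin_le_mul {x c : ℝ} (hc : 0 < c) (hc1 : c ≤ 1) (hx : c ≤ x) :
    |Real.sin x| ≤ x * Real.cos (c / 2) := by
  have hcos : 1 / 2 ≤ Real.cos (c / 2) := by
    have := Real.one_sub_sq_div_two_le_cos (x := c / 2)
    nlinarith
  rcases le_or_gt x Real.pi with h | h
  · rw [abs_of_nonneg (Real.sin_nonneg_of_nonneg_of_le_pi (by linarith) h)]
    have e : Real.sin x = 2 * Real.sin (x / 2) * Real.cos (x / 2) := by
      rw [← Real.sin_two_mul]; congr 1; ring
    have h1 : Real.sin (x / 2) ≤ x / 2 := Real.sin_le (by linarith)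
    have h2 : Real.cos (x / 2) ≤ Real.cos (c / 2) :=
      Real.cos_le_cos_of_nonneg_of_le_pi (by linarith) (by linarith) (by linarith)
    have h3 : 0 ≤ Real.cos (x / 2) :=
      Real.cos_nonneg_of_neg_pi_div_two_le_of_le (by linarith [Real.pi_pos]) (by linarith)
    rw [e]
    nlinarith
  · have := Real.abs_sin_le_one x
    have := Real.pi_gt_three
    nlinarith

lemma abs_sin_sub_taylor_le {y : ℝ} (hy0 : 0 ≤ y) (hy : y ≤ 1) :
    |Real.sin y - (y - y ^ 3 / 6 + y ^ 5 / 120 - y ^ 7 / 5040)| ≤ y ^ 9 := by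
  have hn : ‖(y * Complex.I : ℂ)‖ = y := by simp [abs_of_nonneg hy0]
  have h := Complex.exp_bound (x := y * Complex.I) (by rw [hn]; exact hy) (n := 9) (by norm_num)
  rw [hn] at h
  have him := (Complex.abs_im_le_norm _).trans h
  have e : (Complex.exp (y * Complex.I) -
      ∑ m ∈ Finset.range 9, (y * Complex.I : ℂ) ^ m / (m.factorial : ℂ)).im =
      Real.sin y - (y - y ^ 3 / 6 + y ^ 5 / 120 - y ^ 7 / 5040) := by
    have : ∑ m ∈ Finset.range 9, (y * Complex.I : ℂ) ^ m / (m.factorial : ℂ) =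
        ((1 - y ^ 2 / 2 + y ^ 4 / 24 - y ^ 6 / 720 + y ^ 8 / 40320 : ℝ) : ℂ) +
        ((y - y ^ 3 / 6 + y ^ 5 / 120 - y ^ 7 / 5040 : ℝ) : ℂ) * Complex.I := by
      simp only [Finset.sum_range_succ, Finset.sum_range_zero, Nat.factorial]
      push_cast
      have h2 := Complex.I_sq
      have h3 : Complex.I ^ 3 = -Complex.I := Complex.I_pow_three
      have h4 : Complex.I ^ 4 = 1 := Complex.I_pow_four
      have h5 : Complex.I ^ 5 = Complex.I := by rw [pow_succ, h4, one_mul]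
      have h6 : Complex.I ^ 6 = -1 := by rw [pow_succ, h5, ← sq, h2]
      have h7 : Complex.I ^ 7 = -Complex.I := by rw [pow_succ, h6, neg_one_mul]
      have h8 : Complex.I ^ 8 = 1 := by rw [pow_succ, h7]; simp
      simp only [mul_pow, h2, h3, h4, h5, h6, h7, h8]
      norm_num
      ring
    rw [this, Complex.sub_im, Complex.exp_ofReal_mul_I_im, Complex.add_im, Complex.ofReal_im,
      Complex.im_ofReal_mul, Complex.I_im]
    simp
  rw [e] at him
  refine him.trans (mul_le_of_le_one_right (by positivity) ?_)
  norm_num [Nat.factorial]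

lemma sin_div_self_bounds {y : ℝ} (hy0 : 0 < y) (hy : y ≤ 1) :
    1 - y ^ 2 / 5 ≤ Real.sin y / y ∧ Real.sin y / y ≤ 1 - y ^ 2 / 7 := by
  have h := abs_le.1 (Real.sin_bound (x := y) (by rwa [abs_of_pos hy0]))
  rw [abs_of_pos hy0] at h
  have h5 : y ^ 5 ≤ y ^ 3 := pow_le_pow_of_le_one hy0.le hy (by norm_num)
  have h3 : 0 < y ^ 3 := by positivity
  rw [le_div_iff₀ hy0, div_le_iff₀ hy0]
  constructor <;> nlinarith

/-- The logarithm of the cardinal sine. -/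
noncomputable def logSinc (y : ℝ) : ℝ := Real.log (Real.sin y / y)

lemma sin_eq_mul_exp_logSinc {y : ℝ} (hy0 : 0 < y) (hy : y ≤ 1) :
    Real.sin y = y * Real.exp (logSinc y) := by
  have h := (sin_div_self_bounds hy0 hy).1
  have : 0 < Real.sin y / y := by nlinarith
  rw [logSinc, Real.exp_log this, mul_div_cancel₀ _ hy0.ne']

lemma logSinc_le {y : ℝ} (hy0 : 0 < y) (hy : y ≤ 1) : logSinc y ≤ -(y ^ 2 / 7) := by
  have h := sin_div_self_bounds hy0 hy
  have : 0 < Real.sin y / y := by nlinarith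
  exact (Real.log_le_sub_one_of_pos this).trans (by linarith)

lemma le_logSinc {y : ℝ} (hy0 : 0 < y) (hy : y ≤ 1) : -(y ^ 2 / 4) ≤ logSinc y := by
  have h := sin_div_self_bounds hy0 hy
  have h0 : 4 / 5 ≤ Real.sin y / y := by nlinarith
  have h1 := Real.one_sub_inv_le_log_of_pos (lt_of_lt_of_le (by norm_num) h0)
  refine le_trans ?_ h1
  rw [neg_le_sub_iff_le_add, inv_le_comm₀ (by linarith) (by positivity)]
  refine le_trans ?_ h.1
  rw [inv_le_iff_one_le_mul₀ (by positivity)]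
  nlinarith [sq_nonneg y, mul_nonneg (sq_nonneg y) (by nlinarith : 0 ≤ 1 - y ^ 2)]

lemma abs_logSinc_remainder_le {w : ℝ} (hw0 : 0 ≤ w) (hw1 : w ≤ 1) :
    |(-11/67200) * w ^ 0 + (1/64800) * w ^ 1 + (-23/31752000) * w ^ 2 + (31/1524096000) * w ^ 3 + (-1/3048192000) * w ^ 4 + (1/384072192000) * w ^ 5| ≤ 1 := by
  have h (n : ℕ) : 0 ≤ w ^ n ∧ w ^ n ≤ 1 := ⟨pow_nonneg hw0 n, pow_le_one₀ hw0 hw1⟩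
  obtain ⟨_, _⟩ := h 0
  obtain ⟨_, _⟩ := h 1
  obtain ⟨_, _⟩ := h 2
  obtain ⟨_, _⟩ := h 3
  obtain ⟨_, _⟩ := h 4
  obtain ⟨_, _⟩ := h 5
  rw [abs_le]
  constructor <;> linarith

lemma abs_logSinc_add_le {y : ℝ} (hy0 : 0 < y) (hy : y ≤ 1) :
    |logSinc y + (y ^ 2 / 6 + y ^ 4 / 180 + y ^ 6 / 2835)| ≤ 5 * y ^ 8 := by
  obtain ⟨hl, hu⟩ := sin_div_self_bounds hy0 hy
  set w := y ^ 2 with hw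
  have hw0 : 0 < w := by positivity
  have hw1 : w ≤ 1 := by rw [hw]; nlinarith
  have e4 : y ^ 4 = w ^ 2 := by rw [hw]; ring
  have e6 : y ^ 6 = w ^ 3 := by rw [hw]; ring
  have e8 : y ^ 8 = w ^ 4 := by rw [hw]; ring
  rw [e4, e6, e8]
  set z := 1 - Real.sin y / y with hz
  set p := w / 6 - w ^ 2 / 120 + w ^ 3 / 5040 with hp
  have hzp : |z - p| ≤ w ^ 4 := by
    have h := abs_sin_sub_taylor_le hy0.le hy
    have e : z - p = -((Real.sin y - (y - y ^ 3 / 6 + y ^ 5 / 120 - y ^ 7 / 5040)) / y) := by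
      rw [hz, hp, hw]; field_simp; ring
    rw [e, abs_neg, abs_div, abs_of_pos hy0, div_le_iff₀ hy0, hw]
    calc _ ≤ _ := h
      _ = _ := by ring
  have hz0 : 0 ≤ z := by linarith
  have hz1 : z ≤ w / 5 := by linarith
  have hz2 : z ≤ 1 / 5 := by linarith
  have hw2 : w ^ 2 ≤ w := by nlinarith
  have hw3 : w ^ 3 ≤ w := by nlinarith
  have hw30 : 0 < w ^ 3 := by positivity
  have hw40 : 0 < w ^ 4 := by positivity
  have hp0 : 0 ≤ p := by rw [hp]; nlinarith
  have hp1 : p ≤ 1 / 5 := by rw [hp]; nlinarith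
  have h1 := Real.abs_log_sub_add_sum_range_le (x := z) (by rw [abs_of_nonneg hz0]; linarith) 3
  have e1 : logSinc y = Real.log (1 - z) := by rw [logSinc, hz, sub_sub_cancel]
  rw [← e1, abs_of_nonneg hz0] at h1
  have h1' : z ^ (3 + 1) / (1 - z) ≤ w ^ 4 := by
    rw [div_le_iff₀ (by linarith)]
    have : z ^ 4 ≤ (w / 5) ^ 4 := pow_le_pow_left₀ hz0 hz1 4
    norm_num
    nlinarith
  have h2 : |(z + z ^ 2 / 2 + z ^ 3 / 3) - (p + p ^ 2 / 2 + p ^ 3 / 3)| ≤ 3 * w ^ 4 := by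
    have e : (z + z ^ 2 / 2 + z ^ 3 / 3) - (p + p ^ 2 / 2 + p ^ 3 / 3) =
      (1 + (z + p) / 2 + (z ^ 2 + z * p + p ^ 2) / 3) * (z - p) := by ring
    rw [e, abs_mul, abs_of_nonneg (by positivity)]
    refine mul_le_mul ?_ hzp (abs_nonneg _) (by norm_num)
    nlinarith [mul_nonneg hz0 hp0]
  have h3 : |(p + p ^ 2 / 2 + p ^ 3 / 3) - (w / 6 + w ^ 2 / 180 + w ^ 3 / 2835)| ≤ w ^ 4 := by
    have e : (p + p ^ 2 / 2 + p ^ 3 / 3) - (w / 6 + w ^ 2 / 180 + w ^ 3 / 2835) =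
       w ^ 4 * ((-11/67200) * w ^ 0 + (1/64800) * w ^ 1 + (-23/31752000) * w ^ 2 + (31/1524096000) * w ^ 3 + (-1/3048192000) * w ^ 4 + (1/384072192000) * w ^ 5) := by
      rw [hp]; ring
    rw [e, abs_mul, abs_of_pos hw40]
    exact mul_le_of_le_one_right hw40.le (abs_logSinc_remainder_le hw0.le hw1)
  rw [abs_le] at h1 h2 h3 ⊢
  simp only [Finset.sum_range_succ, Finset.sum_range_zero] at h1
  norm_num at h1
  constructor <;> linarith

/-- The exponent in the product formula for `magicKernel` near the origin. -/
noncomputable def magicExponent (N : ℕ) (x : ℝ) : ℝ :=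
  ∑ i ∈ Finset.range N, (logSinc (((N : ℝ) ^ 2 - i) * x) - logSinc ((i + 1) * x))

lemma scaled_index_bounds {N i : ℕ} (hi : i < N) {x : ℝ} (hx : 0 < x) (hNx : (N : ℝ) ^ 2 * x ≤ 1) :
    (0 < ((N : ℝ) ^ 2 - i) * x ∧ ((N : ℝ) ^ 2 - i) * x ≤ 1) ∧
      (0 < ((i : ℝ) + 1) * x ∧ ((i : ℝ) + 1) * x ≤ 1) := by
  have h1 : (i : ℝ) + 1 ≤ N := by exact_mod_cast hi
  have h0 : (0 : ℝ) ≤ i := Nat.cast_nonneg i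
  have h2 : (N : ℝ) ≤ N ^ 2 := by nlinarith
  refine ⟨⟨by apply mul_pos _ hx; linarith, ?_⟩, ⟨by positivity, ?_⟩⟩
  · refine le_trans ?_ hNx
    gcongr
    linarith
  · refine le_trans ?_ hNx
    gcongr
    linarith

lemma magicKernel_eq_mul_exp (N : ℕ) {x : ℝ} (hx : 0 < x) (hNx : (N : ℝ) ^ 2 * x ≤ 1) :
    magicKernel N (2 * x) =
      (∏ i ∈ Finset.range N, (((N : ℝ) ^ 2 - i) / (i + 1))) * Real.exp (magicExponent N x) := by
  have key := magicKernel_mul_prod_sin N x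
  have e1 : ∏ j ∈ Finset.range N, Real.sin ((j + 1) * x) =
      ∏ j ∈ Finset.range N, (((j + 1) * x) * Real.exp (logSinc ((j + 1) * x))) :=
    Finset.prod_congr rfl fun i hi => by
      have h := (scaled_index_bounds (Finset.mem_range.1 hi) hx hNx).2
      exact sin_eq_mul_exp_logSinc h.1 h.2
  have e2 : ∏ i ∈ Finset.range N, Real.sin (((N : ℝ) ^ 2 - i) * x) =
      ∏ i ∈ Finset.range N, ((((N : ℝ) ^ 2 - i) * x) * Real.exp (logSinc (((N : ℝ) ^ 2 - i) * x))) :=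
    Finset.prod_congr rfl fun i hi => by
      have h := (scaled_index_bounds (Finset.mem_range.1 hi) hx hNx).1
      exact sin_eq_mul_exp_logSinc h.1 h.2
  have hne : ∏ j ∈ Finset.range N, ((((j : ℝ) + 1) * x) * Real.exp (logSinc ((j + 1) * x))) ≠ 0 :=
    Finset.prod_ne_zero_iff.2 fun i _ => by positivity
  rw [e1, e2] at key
  rw [eq_div_of_mul_eq hne key, magicExponent, Real.exp_sum, ← Finset.prod_div_distrib,
    ← Finset.prod_mul_distrib]
  refine Finset.prod_congr rfl fun i _ => ?_
  rw [Real.exp_sub]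
  field_simp

lemma magicExponent_le {N : ℕ} (hN : 10 ≤ N) {x : ℝ} (hx : 0 < x) (hNx : (N : ℝ) ^ 2 * x ≤ 1) :
    magicExponent N x ≤ -((N : ℝ) ^ 5 * x ^ 2 / 12) := by
  have hN' : (10 : ℝ) ≤ N := by exact_mod_cast hN
  have : magicExponent N x ≤ ∑ i ∈ Finset.range N, (-((N : ℝ) ^ 4 * x ^ 2 / 12)) := by
    refine Finset.sum_le_sum fun i hi => ?_
    have h := scaled_index_bounds (Finset.mem_range.1 hi) hx hNx
    have h1 := logSinc_le h.1.1 h.1.2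
    have h2 := le_logSinc h.2.1 h.2.2
    have hi1 : (i : ℝ) + 1 ≤ N := by exact_mod_cast Finset.mem_range.1 hi
    have hi0 : (0 : ℝ) ≤ i := Nat.cast_nonneg i
    have h3 : ((i : ℝ) + 1) ^ 2 ≤ N ^ 2 := by gcongr
    have h4 : ((9 / 10 : ℝ) * N ^ 2) ^ 2 ≤ ((N : ℝ) ^ 2 - i) ^ 2 := by
      gcongr
      nlinarith
    have h5 : (100 : ℝ) * N ^ 2 ≤ N ^ 4 := by
      have : (100 : ℝ) ≤ N ^ 2 := by nlinarith
      nlinarith [sq_nonneg (N : ℝ)]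
    have hx2 : 0 < x ^ 2 := by positivity
    have h6 : (N : ℝ) ^ 4 / 12 + ((i : ℝ) + 1) ^ 2 / 4 - ((N : ℝ) ^ 2 - i) ^ 2 / 7 ≤ 0 := by
      nlinarith
    nlinarith
  refine this.trans (le_of_eq ?_)
  simp
  ring

lemma sum_sq_sub_sq (m : ℝ) (n : ℕ) :
    ∑ i ∈ Finset.range n, ((m - i) ^ 2 - ((i : ℝ) + 1) ^ 2) = n * (m - n) * (m + 1) := by
  induction n with
  | zero => simp
  | succ n ih => rw [Finset.sum_range_succ, ih]; push_cast; ring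

lemma abs_sum_pow_four_sub_le (N : ℕ) :
    |∑ i ∈ Finset.range N, (((N : ℝ) ^ 2 - i) ^ 4 - ((i : ℝ) + 1) ^ 4) - ((N : ℝ) ^ 9 - 2 * (N : ℝ) ^ 8)| ≤
      15 * (N : ℝ) ^ 7 := by
  have hg (n : ℕ) : ∑ i ∈ Finset.range n, ((N : ℝ) ^ 8 - 4 * N ^ 6 * i) =
      n * (N : ℝ) ^ 8 - 2 * N ^ 6 * (n * (n - 1)) := by
    induction n with
    | zero => simp
    | succ n ih => rw [Finset.sum_range_succ, ih]; push_cast; ring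
  have e : ∑ i ∈ Finset.range N, (((N : ℝ) ^ 2 - i) ^ 4 - ((i : ℝ) + 1) ^ 4) - ((N : ℝ) ^ 9 - 2 * (N : ℝ) ^ 8) =
      ∑ i ∈ Finset.range N, (6 * (N : ℝ) ^ 4 * i ^ 2 - 4 * N ^ 2 * i ^ 3 + i ^ 4 - ((i : ℝ) + 1) ^ 4
        + 2 * N ^ 6) := by
    have : ∑ i ∈ Finset.range N, (((N : ℝ) ^ 2 - i) ^ 4 - ((i : ℝ) + 1) ^ 4) =
      ∑ i ∈ Finset.range N, (6 * (N : ℝ) ^ 4 * i ^ 2 - 4 * N ^ 2 * i ^ 3 + i ^ 4 - ((i : ℝ) + 1) ^ 4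
        + 2 * N ^ 6) + ∑ i ∈ Finset.range N, ((N : ℝ) ^ 8 - 4 * N ^ 6 * i)
        - ∑ i ∈ Finset.range N, 2 * (N : ℝ) ^ 6 := by
      rw [← Finset.sum_add_distrib, ← Finset.sum_sub_distrib]
      refine Finset.sum_congr rfl fun i _ => by ring
    rw [this, hg]
    simp
    ring
  rw [e]
  refine (Finset.abs_sum_le_sum_abs _ _).trans ?_
  calc _ ≤ ∑ i ∈ Finset.range N, 15 * (N : ℝ) ^ 6 := by
        refine Finset.sum_le_sum fun i hi => ?_
        have hi1 : (i : ℝ) + 1 ≤ N := by exact_mod_cast Finset.mem_range.1 hi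
        have hi0 : (0 : ℝ) ≤ i := Nat.cast_nonneg i
        have hN1 : (1 : ℝ) ≤ N := by linarith
        have h2 : (i : ℝ) ^ 2 ≤ N ^ 2 := by gcongr; exact (Finset.mem_range.1 hi).le
        have h3 : (i : ℝ) ^ 3 ≤ N ^ 3 := by gcongr; exact (Finset.mem_range.1 hi).le
        have h4 : (i : ℝ) ^ 4 ≤ N ^ 4 := by gcongr; exact (Finset.mem_range.1 hi).le
        have h4' : ((i : ℝ) + 1) ^ 4 ≤ N ^ 4 := by gcongr
        have p2 : (N : ℝ) ^ 4 * i ^ 2 ≤ N ^ 6 := by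
          calc _ ≤ (N : ℝ) ^ 4 * N ^ 2 := by gcongr
            _ = _ := by ring
        have p3 : (N : ℝ) ^ 2 * i ^ 3 ≤ N ^ 6 := by
          calc _ ≤ (N : ℝ) ^ 2 * N ^ 3 := by gcongr
            _ = N ^ 5 := by ring
            _ ≤ _ := pow_le_pow_right₀ hN1 (by norm_num)
        have p4 : (N : ℝ) ^ 4 ≤ N ^ 6 := pow_le_pow_right₀ hN1 (by norm_num)
        have q2 : 0 ≤ (N : ℝ) ^ 4 * i ^ 2 := by positivity
        have q3 : 0 ≤ (N : ℝ) ^ 2 * i ^ 3 := by positivity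
        have q4 : 0 ≤ (i : ℝ) ^ 4 := by positivity
        have q5 : 0 ≤ ((i : ℝ) + 1) ^ 4 := by positivity
        rw [abs_le]
        constructor <;> linarith
    _ = _ := by simp; ring

lemma abs_sum_pow_six_sub_le (N : ℕ) :
    |∑ i ∈ Finset.range N, (((N : ℝ) ^ 2 - i) ^ 6 - ((i : ℝ) + 1) ^ 6) - (N : ℝ) ^ 13| ≤
      65 * (N : ℝ) ^ 12 := by
  have e : ∑ i ∈ Finset.range N, (((N : ℝ) ^ 2 - i) ^ 6 - ((i : ℝ) + 1) ^ 6) - (N : ℝ) ^ 13 =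
      ∑ i ∈ Finset.range N, (((N : ℝ) ^ 2 - i) ^ 6 - ((i : ℝ) + 1) ^ 6 - N ^ 12) := by
    rw [Finset.sum_sub_distrib _ (fun _ => (N : ℝ) ^ 12)]
    simp
    ring
  rw [e]
  refine (Finset.abs_sum_le_sum_abs _ _).trans ?_
  calc _ ≤ ∑ i ∈ Finset.range N, 65 * (N : ℝ) ^ 11 := by
        refine Finset.sum_le_sum fun i hi => ?_
        have hi1 : (i : ℝ) + 1 ≤ N := by exact_mod_cast Finset.mem_range.1 hi
        have hi0 : (0 : ℝ) ≤ i := Nat.cast_nonneg i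
        have hN1 : (1 : ℝ) ≤ N := by linarith
        have h6 : ((i : ℝ) + 1) ^ 6 ≤ N ^ 6 := by gcongr
        have hk (k : ℕ) (hk : k ≤ 6) (hk1 : 1 ≤ k) :
            0 ≤ (N : ℝ) ^ (12 - 2 * k) * i ^ k ∧ (N : ℝ) ^ (12 - 2 * k) * i ^ k ≤ N ^ 11 := by
          refine ⟨by positivity, ?_⟩
          calc (N : ℝ) ^ (12 - 2 * k) * i ^ k ≤ (N : ℝ) ^ (12 - 2 * k) * N ^ k := by
                gcongr; exact (Finset.mem_range.1 hi).le
            _ = N ^ (12 - 2 * k + k) := (pow_add _ _ _).symm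
            _ ≤ _ := pow_le_pow_right₀ hN1 (by omega)
        have p6 : (N : ℝ) ^ 6 ≤ N ^ 11 := pow_le_pow_right₀ hN1 (by norm_num)
        have q6 : 0 ≤ ((i : ℝ) + 1) ^ 6 := by positivity
        have k1 := hk 1 (by norm_num) (by norm_num)
        have k2 := hk 2 (by norm_num) (by norm_num)
        have k3 := hk 3 (by norm_num) (by norm_num)
        have k4 := hk 4 (by norm_num) (by norm_num)
        have k5 := hk 5 (by norm_num) (by norm_num)
        have k6 := hk 6 (by norm_num) (by norm_num)
        have q7 : 0 ≤ (i : ℝ) ^ 6 := by positivity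
        norm_num at k1 k2 k3 k4 k5 k6
        have e : ((N : ℝ) ^ 2 - i) ^ 6 - ((i : ℝ) + 1) ^ 6 - N ^ 12 =
          -6 * (N ^ 10 * i) + 15 * (N ^ 8 * i ^ 2) - 20 * (N ^ 6 * i ^ 3) + 15 * (N ^ 4 * i ^ 4)
            - 6 * (N ^ 2 * i ^ 5) + i ^ 6 - ((i : ℝ) + 1) ^ 6 := by ring
        rw [e, abs_le]
        constructor <;> linarith
    _ = _ := by simp; ring

lemma abs_sub_add_le_of_expansions {a b x u v B : ℝ}
    (hu : |u + ((a * x) ^ 2 / 6 + (a * x) ^ 4 / 180 + (a * x) ^ 6 / 2835)| ≤ 5 * (a * x) ^ 8)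
    (hv : |v + ((b * x) ^ 2 / 6 + (b * x) ^ 4 / 180 + (b * x) ^ 6 / 2835)| ≤ 5 * (b * x) ^ 8)
    (ha : (a * x) ^ 8 ≤ B) (hb : (b * x) ^ 8 ≤ B) :
    |u - v + (x ^ 2 / 6 * (a ^ 2 - b ^ 2) + x ^ 4 / 180 * (a ^ 4 - b ^ 4) +
      x ^ 6 / 2835 * (a ^ 6 - b ^ 6))| ≤ 10 * B := by
  have e : u - v + (x ^ 2 / 6 * (a ^ 2 - b ^ 2) + x ^ 4 / 180 * (a ^ 4 - b ^ 4) +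
      x ^ 6 / 2835 * (a ^ 6 - b ^ 6)) =
      (u + ((a * x) ^ 2 / 6 + (a * x) ^ 4 / 180 + (a * x) ^ 6 / 2835)) -
      (v + ((b * x) ^ 2 / 6 + (b * x) ^ 4 / 180 + (b * x) ^ 6 / 2835)) := by ring
  rw [e]
  refine (abs_sub _ _).trans ?_
  linarith

lemma abs_magicExponent_add_powerSums_le {N : ℕ} {x : ℝ} (hx : 0 < x)
    (hNx : (N : ℝ) ^ 2 * x ≤ 1) :
    |magicExponent N x + (x ^ 2 / 6 * (N * (N ^ 2 - N) * (N ^ 2 + 1)) +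
      x ^ 4 / 180 * ∑ i ∈ Finset.range N, (((N : ℝ) ^ 2 - i) ^ 4 - ((i : ℝ) + 1) ^ 4) +
      x ^ 6 / 2835 * ∑ i ∈ Finset.range N, (((N : ℝ) ^ 2 - i) ^ 6 - ((i : ℝ) + 1) ^ 6))| ≤
      10 * N ^ 17 * x ^ 8 := by
  rw [← sum_sq_sub_sq, magicExponent, Finset.mul_sum, Finset.mul_sum, Finset.mul_sum,
    ← Finset.sum_add_distrib, ← Finset.sum_add_distrib, ← Finset.sum_add_distrib]
  refine (Finset.abs_sum_le_sum_abs _ _).trans ?_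
  calc _ ≤ ∑ i ∈ Finset.range N, 10 * ((N : ℝ) ^ 16 * x ^ 8) := by
        refine Finset.sum_le_sum fun i hi => ?_
        have h := scaled_index_bounds (Finset.mem_range.1 hi) hx hNx
        have h1 := abs_logSinc_add_le h.1.1 h.1.2
        have h2 := abs_logSinc_add_le h.2.1 h.2.2
        have hi1 : (i : ℝ) + 1 ≤ N := by exact_mod_cast Finset.mem_range.1 hi
        have hi0 : (0 : ℝ) ≤ i := Nat.cast_nonneg i
        have h3 : (((N : ℝ) ^ 2 - i) * x) ^ 8 ≤ (N : ℝ) ^ 16 * x ^ 8 := by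
          calc _ ≤ ((N : ℝ) ^ 2 * x) ^ 8 := by
                gcongr
                · exact h.1.1.le
                · linarith
            _ = _ := by ring
        have h4 : (((i : ℝ) + 1) * x) ^ 8 ≤ (N : ℝ) ^ 16 * x ^ 8 := by
          calc _ ≤ ((N : ℝ) ^ 2 * x) ^ 8 := by
                gcongr
                nlinarith
            _ = _ := by ring
        exact abs_sub_add_le_of_expansions h1 h2 h3 h4
    _ = _ := by simp; ring

lemma abs_magicExponent_add_le {N : ℕ} (hN : 1 ≤ N) {x T : ℝ} (hx : 0 < x)
    (hNx : (N : ℝ) ^ 2 * x ≤ 1) (hT : 4 * (N : ℝ) ^ 5 * x ^ 2 = T) :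
    |magicExponent N x + T / 24 - (T / 24 - T ^ 2 / 2880) / N -
        (-T / 24 + T ^ 2 / 1440 - T ^ 3 / 181440) / N ^ 2| ≤
      (T + T ^ 2 + T ^ 3 + T ^ 4) / N ^ 3 := by
  have hN0 : (0 : ℝ) < N := by exact_mod_cast hN
  have hT0 : 0 < T := by rw [← hT]; positivity
  have hx2 : x ^ 2 = T / (4 * N ^ 5) := by rw [← hT]; field_simp
  have hx4 : x ^ 4 = T ^ 2 / (16 * N ^ 10) := by
    rw [show x ^ 4 = (x ^ 2) ^ 2 by ring, hx2]; field_simp; norm_num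
  have hx6 : x ^ 6 = T ^ 3 / (64 * N ^ 15) := by
    rw [show x ^ 6 = (x ^ 2) ^ 3 by ring, hx2]; field_simp; norm_num
  have hx8 : x ^ 8 = T ^ 4 / (256 * N ^ 20) := by
    rw [show x ^ 8 = (x ^ 2) ^ 4 by ring, hx2]; field_simp; norm_num
  set P4 := ∑ i ∈ Finset.range N, (((N : ℝ) ^ 2 - i) ^ 4 - ((i : ℝ) + 1) ^ 4) with hP4
  set P6 := ∑ i ∈ Finset.range N, (((N : ℝ) ^ 2 - i) ^ 6 - ((i : ℝ) + 1) ^ 6) with hP6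
  have b4 := abs_sum_pow_four_sub_le N
  have b6 := abs_sum_pow_six_sub_le N
  rw [← hP4] at b4
  rw [← hP6] at b6
  have hR := abs_magicExponent_add_powerSums_le hx hNx
  rw [← hP4, ← hP6] at hR
  have e : magicExponent N x + T / 24 - (T / 24 - T ^ 2 / 2880) / N -
        (-T / 24 + T ^ 2 / 1440 - T ^ 3 / 181440) / N ^ 2 =
      (magicExponent N x + (x ^ 2 / 6 * (N * (N ^ 2 - N) * (N ^ 2 + 1)) + x ^ 4 / 180 * P4 +
      x ^ 6 / 2835 * P6)) + T / (24 * N ^ 3) - T ^ 2 / (2880 * N ^ 10) * (P4 - ((N : ℝ) ^ 9 - 2 * (N : ℝ) ^ 8))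
      - T ^ 3 / (181440 * N ^ 15) * (P6 - N ^ 13) := by
    rw [hx2, hx4, hx6]
    field_simp
    ring
  have c1 : |T / (24 * (N : ℝ) ^ 3)| ≤ T / N ^ 3 := by
    rw [abs_of_pos (by positivity)]
    gcongr
    have : (0 : ℝ) < N ^ 3 := by positivity
    linarith
  have c2 : |T ^ 2 / (2880 * N ^ 10) * (P4 - ((N : ℝ) ^ 9 - 2 * (N : ℝ) ^ 8))| ≤ T ^ 2 / N ^ 3 := by
    rw [abs_mul, abs_of_pos (by positivity)]
    calc _ ≤ T ^ 2 / (2880 * N ^ 10) * (15 * (N : ℝ) ^ 7) := by gcongr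
      _ = (15 / 2880) * (T ^ 2 / N ^ 3) := by field_simp
      _ ≤ _ := mul_le_of_le_one_left (by positivity) (by norm_num)
  have c3 : |T ^ 3 / (181440 * N ^ 15) * (P6 - N ^ 13)| ≤ T ^ 3 / N ^ 3 := by
    rw [abs_mul, abs_of_pos (by positivity)]
    calc _ ≤ T ^ 3 / (181440 * N ^ 15) * (65 * (N : ℝ) ^ 12) := by gcongr
      _ = (65 / 181440) * (T ^ 3 / N ^ 3) := by field_simp
      _ ≤ _ := mul_le_of_le_one_left (by positivity) (by norm_num)
  have c4 : 10 * (N : ℝ) ^ 17 * x ^ 8 ≤ T ^ 4 / N ^ 3 := by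
    rw [hx8]
    calc _ = (10 / 256) * (T ^ 4 / N ^ 3) := by field_simp
      _ ≤ _ := mul_le_of_le_one_left (by positivity) (by norm_num)
  have hs : (T + T ^ 2 + T ^ 3 + T ^ 4) / (N : ℝ) ^ 3 =
      T / N ^ 3 + T ^ 2 / N ^ 3 + T ^ 3 / N ^ 3 + T ^ 4 / N ^ 3 := by ring
  rw [e, hs]
  rw [abs_le] at *
  constructor <;> linarith

lemma abs_exp_sub_quadratic_le (v : ℝ) :
    |Real.exp v - (1 + v + v ^ 2 / 2)| ≤ |v| ^ 3 * Real.exp |v| := by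
  have h := Complex.norm_exp_sub_sum_le_norm_mul_exp (v : ℂ) 3
  have e : Complex.exp v - ∑ m ∈ Finset.range 3, (v : ℂ) ^ m / (m.factorial : ℂ) =
      ((Real.exp v - (1 + v + v ^ 2 / 2) : ℝ) : ℂ) := by
    simp [Finset.sum_range_succ, Nat.factorial]
  rwa [e, Complex.norm_real, Complex.norm_real] at h

lemma abs_exp_sub_expansion_le {h B u₁ u₂ v : ℝ} (hh : 0 < h) (hh1 : h ≤ 1) (hB : 1 ≤ B)
    (h₁ : |u₁| ≤ B) (h₂ : |u₂| ≤ B) (hv : |v - (u₁ * h + u₂ * h ^ 2)| ≤ B * h ^ 3) :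
    |Real.exp v - (1 + u₁ * h + (u₁ ^ 2 / 2 + u₂) * h ^ 2)| ≤
      32 * B ^ 3 * h ^ 3 * Real.exp |v| := by
  have hh2 : h ^ 2 ≤ h := by nlinarith
  have hh3 : h ^ 3 ≤ h ^ 2 := by nlinarith
  have hv1 : |v - u₁ * h| ≤ 2 * B * h ^ 2 := by
    have e : v - u₁ * h = (v - (u₁ * h + u₂ * h ^ 2)) + u₂ * h ^ 2 := by ring
    rw [e]
    refine (abs_add_le _ _).trans ?_
    rw [abs_mul, abs_of_nonneg (sq_nonneg h)]
    nlinarith [mul_le_mul_of_nonneg_right h₂ (sq_nonneg h)]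
  have hu1 : |u₁ * h| ≤ B * h := by rw [abs_mul, abs_of_pos hh]; gcongr
  have hv2 : |v| ≤ 3 * B * h := by
    have e : v = (v - u₁ * h) + u₁ * h := by ring
    rw [e]
    refine (abs_add_le _ _).trans ?_
    nlinarith
  have hv3 : |v + u₁ * h| ≤ 4 * B * h := (abs_add_le _ _).trans (by linarith)
  have hprod : |(v - u₁ * h) * (v + u₁ * h)| ≤ 8 * B ^ 2 * h ^ 3 := by
    rw [abs_mul]
    calc _ ≤ (2 * B * h ^ 2) * (4 * B * h) := by gcongr
      _ = _ := by ring
  have hexp := abs_exp_sub_quadratic_le v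
  have hE : 1 ≤ Real.exp |v| := Real.one_le_exp (abs_nonneg v)
  have hcube : |v| ^ 3 * Real.exp |v| ≤ 27 * B ^ 3 * h ^ 3 * Real.exp |v| := by
    have : |v| ^ 3 ≤ (3 * B * h) ^ 3 := by gcongr
    have e : (3 * B * h) ^ 3 = 27 * B ^ 3 * h ^ 3 := by ring
    rw [e] at this
    gcongr
  have e : Real.exp v - (1 + u₁ * h + (u₁ ^ 2 / 2 + u₂) * h ^ 2) =
      (Real.exp v - (1 + v + v ^ 2 / 2)) + (v - (u₁ * h + u₂ * h ^ 2)) +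
        ((v - u₁ * h) * (v + u₁ * h)) / 2 := by ring
  rw [e]
  have hB2 : B ^ 2 ≤ B ^ 3 := by nlinarith [sq_nonneg B]
  have hB1 : B ≤ B ^ 3 := by nlinarith
  have hh30 : 0 < h ^ 3 := by positivity
  have t1 : B * h ^ 3 ≤ B ^ 3 * h ^ 3 := by gcongr
  have t2 : B ^ 2 * h ^ 3 ≤ B ^ 3 * h ^ 3 := by gcongr
  have t3 : B ^ 3 * h ^ 3 ≤ B ^ 3 * h ^ 3 * Real.exp |v| := le_mul_of_one_le_right (by positivity) hE
  refine (abs_add_le _ _).trans ?_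
  refine (add_le_add_left (abs_add_le _ _) _).trans ?_
  rw [abs_div, abs_two]
  linarith

lemma le_log_stirlingSeq_sdiff {n : ℕ} (hn : 1 ≤ n) :
    1 / (3 * (2 * (n : ℝ) + 1) ^ 2) ≤
      Real.log (Stirling.stirlingSeq n) - Real.log (Stirling.stirlingSeq (n + 1)) := by
  obtain ⟨m, rfl⟩ : ∃ m, n = m + 1 := ⟨n - 1, by omega⟩
  have h := le_hasSum (Stirling.log_stirlingSeq_sdiff_hasSum m) 0 fun j _ => by positivity
  refine le_trans (le_of_eq ?_) h
  push_cast
  field_simp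
  norm_num

lemma log_stirlingSeq_bounds {n : ℕ} (hn : 1 ≤ n) :
    1 / (12 * (n : ℝ)) - 1 / n ^ 3 ≤ Real.log (Stirling.stirlingSeq n) - Real.log √Real.pi ∧
      Real.log (Stirling.stirlingSeq n) - Real.log √Real.pi ≤ 1 / (12 * (n : ℝ)) := by
  have hlim : Tendsto (fun k => Real.log (Stirling.stirlingSeq k)) atTop
      (nhds (Real.log √Real.pi)) :=
    Stirling.tendsto_stirlingSeq_sqrt_pi.log (by positivity)
  have hinv : Tendsto (fun k : ℕ => 1 / (12 * (k : ℝ))) atTop (nhds 0) := by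
    have := (tendsto_one_div_atTop_nhds_zero_nat (𝕜 := ℝ)).const_mul (1 / 12)
    rw [mul_zero] at this
    refine this.congr fun k => ?_
    ring
  have hinv3 : Tendsto (fun k : ℕ => 1 / (k : ℝ) ^ 3) atTop (nhds 0) := by
    have := (tendsto_one_div_atTop_nhds_zero_nat (𝕜 := ℝ)).pow 3
    simpa using this
  constructor
  · have hl := ((hlim.sub hinv).add hinv3)
    have hanti : ∀ k, n ≤ k →
        Real.log (Stirling.stirlingSeq k) - 1 / (12 * (k : ℝ)) + 1 / (k : ℝ) ^ 3 ≤
        Real.log (Stirling.stirlingSeq n) - 1 / (12 * (n : ℝ)) + 1 / (n : ℝ) ^ 3 := by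
      intro k hk
      induction k, hk using Nat.le_induction with
      | base => exact le_rfl
      | succ k hk ih =>
        refine le_trans ?_ ih
        have hs := le_log_stirlingSeq_sdiff (hn.trans hk)
        have hk1 : (1 : ℝ) ≤ k := by exact_mod_cast hn.trans hk
        have : 1 / (12 * (k : ℝ)) - 1 / (12 * ((k : ℝ) + 1)) - 1 / (3 * (2 * (k : ℝ) + 1) ^ 2) ≤
            1 / (k : ℝ) ^ 3 - 1 / ((k : ℝ) + 1) ^ 3 := by
          have e1 : 1 / (12 * (k : ℝ)) - 1 / (12 * ((k : ℝ) + 1)) - 1 / (3 * (2 * (k : ℝ) + 1) ^ 2) =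
            1 / (12 * k * (k + 1) * (2 * k + 1) ^ 2) := by field_simp; ring
          have e2 : 1 / (k : ℝ) ^ 3 - 1 / ((k : ℝ) + 1) ^ 3 =
              (3 * k ^ 2 + 3 * k + 1) / (k ^ 3 * (k + 1) ^ 3) := by field_simp; ring
          rw [e1, e2, div_le_div_iff₀ (by positivity) (by positivity)]
          have : 0 < (k : ℝ) * (k + 1) := by positivity
          have h1 : (k : ℝ) ^ 2 * (k + 1) ^ 2 ≤ (3 * k ^ 2 + 3 * k + 1) * (12 * (2 * k + 1) ^ 2) := by
            calc (k : ℝ) ^ 2 * (k + 1) ^ 2 = (k * (k + 1)) * (k * (k + 1)) := by ring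
              _ ≤ _ := by apply mul_le_mul <;> nlinarith
          nlinarith [mul_le_mul_of_nonneg_left h1 this.le]
        push_cast
        linarith
    have := le_of_tendsto hl (eventually_atTop.2 ⟨n, hanti⟩)
    linarith
  · have hl := hlim.sub hinv
    have hmono : ∀ k, n ≤ k →
        Real.log (Stirling.stirlingSeq n) - 1 / (12 * (n : ℝ)) ≤
        Real.log (Stirling.stirlingSeq k) - 1 / (12 * (k : ℝ)) := by
      intro k hk
      induction k, hk using Nat.le_induction with
      | base => exact le_rfl
      | succ k hk ih =>
        refine ih.trans ?_
        have hs := Stirling.log_stirlingSeq_sdiff_le k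
        have hk1 : (1 : ℝ) ≤ k := by exact_mod_cast hn.trans hk
        have e1 : 1 / (12 * (k : ℝ)) - 1 / (12 * ((k : ℝ) + 1)) = 1 / (12 * k * (k + 1)) := by
          field_simp; ring
        push_cast
        linarith
    have := ge_of_tendsto hl (eventually_atTop.2 ⟨n, hmono⟩)
    linarith

lemma abs_log_one_sub_add_le {z : ℝ} (hz0 : 0 ≤ z) (hz : z ≤ 1 / 2) :
    |Real.log (1 - z) + z + z ^ 2 / 2 + z ^ 3 / 3| ≤ 2 * z ^ 4 := by
  have h := Real.abs_log_sub_add_sum_range_le (x := z) (by rw [abs_of_nonneg hz0]; linarith) 3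
  rw [abs_of_nonneg hz0] at h
  simp only [Finset.sum_range_succ, Finset.sum_range_zero] at h
  norm_num at h
  have e : Real.log (1 - z) + z + z ^ 2 / 2 + z ^ 3 / 3 =
      z + z ^ 2 / 2 + z ^ 3 / 3 + Real.log (1 - z) := by ring
  rw [e]
  refine h.trans ?_
  rw [div_le_iff₀ (by linarith)]
  nlinarith [pow_nonneg hz0 4]

lemma abs_sum_log_one_sub_le {N : ℕ} (hN : 2 ≤ N) :
    |∑ i ∈ Finset.range N, Real.log (1 - (i : ℝ) / (N : ℝ) ^ 2) + 1 / 2 -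
      (1 / (3 * N) + 1 / (6 * (N : ℝ) ^ 2))| ≤ 3 / (N : ℝ) ^ 3 := by
  have hN2 : (2 : ℝ) ≤ N := by exact_mod_cast hN
  have hN0 : (0 : ℝ) < N := by linarith
  have hs1 : ∑ i ∈ Finset.range N, (i : ℝ) / (N : ℝ) ^ 2 = 1 / 2 - 1 / (2 * N) := by
    have h (n : ℕ) : ∑ i ∈ Finset.range n, (i : ℝ) = n * (n - 1) / 2 := by
      induction n with
      | zero => simp
      | succ n ih => rw [Finset.sum_range_succ, ih]; push_cast; ring
    rw [← Finset.sum_div, h]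
    field_simp
  have hs2 : ∑ i ∈ Finset.range N, ((i : ℝ) / (N : ℝ) ^ 2) ^ 2 =
      1 / (3 * N) - 1 / (2 * N ^ 2) + 1 / (6 * N ^ 3) := by
    have h (n : ℕ) : ∑ i ∈ Finset.range n, (i : ℝ) ^ 2 = n * (n - 1) * (2 * n - 1) / 6 := by
      induction n with
      | zero => simp
      | succ n ih => rw [Finset.sum_range_succ, ih]; push_cast; ring
    simp only [div_pow]
    rw [← Finset.sum_div, h]
    field_simp
    ring
  have hs3 : ∑ i ∈ Finset.range N, ((i : ℝ) / (N : ℝ) ^ 2) ^ 3 =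
      1 / (4 * N ^ 2) - 1 / (2 * N ^ 3) + 1 / (4 * N ^ 4) := by
    have h (n : ℕ) : ∑ i ∈ Finset.range n, (i : ℝ) ^ 3 = (n * (n - 1) / 2) ^ 2 := by
      induction n with
      | zero => simp
      | succ n ih => rw [Finset.sum_range_succ, ih]; push_cast; ring
    simp only [div_pow]
    rw [← Finset.sum_div, h]
    field_simp
    ring
  have hR : |∑ i ∈ Finset.range N, (Real.log (1 - (i : ℝ) / (N : ℝ) ^ 2) + (i : ℝ) / (N : ℝ) ^ 2 +
      ((i : ℝ) / (N : ℝ) ^ 2) ^ 2 / 2 + ((i : ℝ) / (N : ℝ) ^ 2) ^ 3 / 3)| ≤ 2 / (N : ℝ) ^ 3 := by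
    refine (Finset.abs_sum_le_sum_abs _ _).trans ?_
    calc _ ≤ ∑ i ∈ Finset.range N, 2 / (N : ℝ) ^ 4 := by
          refine Finset.sum_le_sum fun i hi => ?_
          have hi1 : (i : ℝ) ≤ N := by exact_mod_cast (Finset.mem_range.1 hi).le
          have hz : (i : ℝ) / (N : ℝ) ^ 2 ≤ 1 / N := by
            rw [div_le_div_iff₀ (by positivity) hN0]
            nlinarith
          have hz2 : (1 : ℝ) / N ≤ 1 / 2 := one_div_le_one_div_of_le (by norm_num) hN2
          refine (abs_log_one_sub_add_le (by positivity) (hz.trans hz2)).trans ?_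
          calc 2 * ((i : ℝ) / (N : ℝ) ^ 2) ^ 4 ≤ 2 * (1 / N) ^ 4 := by gcongr
            _ = _ := by ring
      _ = _ := by simp; field_simp
  simp only [Finset.sum_add_distrib, ← Finset.sum_div] at hR
  rw [Finset.sum_div, hs1, hs2, hs3] at hR
  have h3 : 0 < 1 / (N : ℝ) ^ 3 := by positivity
  have h4 : 1 / (N : ℝ) ^ 4 ≤ 1 / (N : ℝ) ^ 3 := by
    apply one_div_le_one_div_of_le (by positivity)
    exact pow_le_pow_right₀ (by linarith) (by norm_num)
  have h40 : 0 < 1 / (N : ℝ) ^ 4 := by positivity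
  have e1 : 1 / (3 * (N : ℝ)) = (1 / N) / 3 := by ring
  have e2 : 1 / (2 * (N : ℝ)) = (1 / N) / 2 := by ring
  have e3 : 1 / (6 * (N : ℝ) ^ 3) = (1 / N ^ 3) / 6 := by ring
  have e4 : 1 / (2 * (N : ℝ) ^ 3) = (1 / N ^ 3) / 2 := by ring
  have e5 : 1 / (4 * (N : ℝ) ^ 4) = (1 / N ^ 4) / 4 := by ring
  have e6 : 1 / (2 * (N : ℝ) ^ 2) = (1 / N ^ 2) / 2 := by ring
  have e7 : 1 / (4 * (N : ℝ) ^ 2) = (1 / N ^ 2) / 4 := by ring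
  have e8 : 1 / (6 * (N : ℝ) ^ 2) = (1 / N ^ 2) / 6 := by ring
  have e9 : 3 / (N : ℝ) ^ 3 = 3 * (1 / N ^ 3) := by ring
  have e10 : 2 / (N : ℝ) ^ 3 = 2 * (1 / N ^ 3) := by ring
  rw [e1, e2, e3, e4, e5, e6, e7, e10] at hR
  rw [e1, e8, e9]
  rw [abs_le] at hR ⊢
  constructor <;> linarith [hR.1, hR.2]

lemma prod_ratio_mul_sqrt_eq {N : ℕ} (hN : 2 ≤ N) :
    (∏ i ∈ Finset.range N, (((N : ℝ) ^ 2 - i) / (i + 1))) *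
        (√(2 * N) * √Real.pi * Real.exp (1 / 2)) =
      (N * Real.exp 1) ^ N *
        Real.exp (∑ i ∈ Finset.range N, Real.log (1 - (i : ℝ) / (N : ℝ) ^ 2) + 1 / 2 -
          (Real.log (Stirling.stirlingSeq N) - Real.log √Real.pi)) := by
  have hN2 : (2 : ℝ) ≤ N := by exact_mod_cast hN
  have hN0 : (0 : ℝ) < N := by linarith
  have hpi : 0 < √Real.pi := by positivity
  have hs : 0 < Stirling.stirlingSeq N := by
    obtain ⟨m, rfl⟩ : ∃ m, N = m + 1 := ⟨N - 1, by omega⟩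
    exact Stirling.stirlingSeq'_pos m
  have hden : ∏ i ∈ Finset.range N, ((i : ℝ) + 1) = N.factorial := by
    rw [← Finset.prod_range_add_one_eq_factorial]; push_cast; rfl
  have hnum : ∏ i ∈ Finset.range N, ((N : ℝ) ^ 2 - i) =
      ((N : ℝ) ^ 2) ^ N * ∏ i ∈ Finset.range N, (1 - (i : ℝ) / (N : ℝ) ^ 2) := by
    have : ((N : ℝ) ^ 2) ^ N = ∏ i ∈ Finset.range N, (N : ℝ) ^ 2 := by simp
    rw [this, ← Finset.prod_mul_distrib]
    refine Finset.prod_congr rfl fun i _ => ?_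
    field_simp
  have hlog : Real.exp (∑ i ∈ Finset.range N, Real.log (1 - (i : ℝ) / (N : ℝ) ^ 2)) =
      ∏ i ∈ Finset.range N, (1 - (i : ℝ) / (N : ℝ) ^ 2) := by
    rw [Real.exp_sum]
    refine Finset.prod_congr rfl fun i hi => Real.exp_log ?_
    have hi1 : (i : ℝ) < N := by exact_mod_cast Finset.mem_range.1 hi
    rw [sub_pos, div_lt_one (by positivity)]
    nlinarith
  have hfac : (N.factorial : ℝ) =
      Stirling.stirlingSeq N * (√(2 * N) * (N / Real.exp 1) ^ N) := by
    rw [Stirling.stirlingSeq, div_mul_cancel₀ _ (by positivity)]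
  rw [Finset.prod_div_distrib, hden, hnum, Real.exp_sub, Real.exp_add, hlog, Real.exp_sub,
    Real.exp_log hs, Real.exp_log hpi, hfac, mul_pow, div_pow, ← pow_mul, mul_comm 2 N, pow_mul]
  field_simp

lemma abs_prod_ratio_exponent_sub_le {N : ℕ} (hN : 2 ≤ N) :
    |∑ i ∈ Finset.range N, Real.log (1 - (i : ℝ) / (N : ℝ) ^ 2) + 1 / 2 -
        (Real.log (Stirling.stirlingSeq N) - Real.log √Real.pi) -
      (1 / 4 * (1 / (N : ℝ)) + 1 / 6 * (1 / (N : ℝ)) ^ 2)| ≤ 4 * (1 / (N : ℝ)) ^ 3 := by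
  have h1 := abs_le.1 (abs_sum_log_one_sub_le hN)
  have h2 := log_stirlingSeq_bounds (n := N) (by omega)
  have e1 : 1 / (3 * (N : ℝ)) = (1 / N) / 3 := by ring
  have e2 : 1 / (6 * (N : ℝ) ^ 2) = (1 / N) ^ 2 / 6 := by ring
  have e3 : 1 / (N : ℝ) ^ 3 = (1 / N) ^ 3 := by ring
  have e4 : 3 / (N : ℝ) ^ 3 = 3 * (1 / N) ^ 3 := by ring
  have e5 : 1 / (12 * (N : ℝ)) = (1 / N) / 12 := by ring
  rw [e1, e2, e4] at h1
  rw [e3, e5] at h2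
  rw [abs_le]
  constructor <;> linarith [h1.1, h1.2, h2.1, h2.2]

lemma abs_prod_ratio_sub_le {N : ℕ} (hN : 2 ≤ N) :
    |(∏ i ∈ Finset.range N, (((N : ℝ) ^ 2 - i) / (i + 1))) *
          (√(2 * N) * √Real.pi * Real.exp (1 / 2)) * ((N * Real.exp 1) ^ N)⁻¹ -
        (1 + 1 / 4 * (1 / (N : ℝ)) + 19 / 96 * (1 / (N : ℝ)) ^ 2)| ≤
      2048 * Real.exp 5 * (1 / (N : ℝ)) ^ 3 := by
  have hN2 : (2 : ℝ) ≤ N := by exact_mod_cast hN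
  have hN0 : (0 : ℝ) < N := by linarith
  have hh : 0 < 1 / (N : ℝ) := by positivity
  have hh1 : 1 / (N : ℝ) ≤ 1 / 2 := one_div_le_one_div_of_le (by norm_num) hN2
  rw [prod_ratio_mul_sqrt_eq hN, mul_comm ((N * Real.exp 1) ^ N : ℝ), mul_assoc,
    mul_inv_cancel₀ (by positivity), mul_one]
  have hv := abs_prod_ratio_exponent_sub_le hN
  set v := ∑ i ∈ Finset.range N, Real.log (1 - (i : ℝ) / (N : ℝ) ^ 2) + 1 / 2 -
        (Real.log (Stirling.stirlingSeq N) - Real.log √Real.pi)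
  set h := 1 / (N : ℝ)
  have key := abs_exp_sub_expansion_le hh (by linarith) (B := 4) (by norm_num) (u₁ := 1 / 4)
    (u₂ := 1 / 6) (by norm_num [abs_of_pos]) (by norm_num [abs_of_pos]) hv
  have e : (1 : ℝ) + 1 / 4 * h + ((1 / 4) ^ 2 / 2 + 1 / 6) * h ^ 2 =
      1 + 1 / 4 * h + 19 / 96 * h ^ 2 := by ring
  rw [e] at key
  have hv5 : |v| ≤ 5 := by
    have h2 : h ^ 2 ≤ 1 / 4 := by nlinarith
    have h3 : h ^ 3 ≤ 1 / 8 := by nlinarith [pow_pos hh 2]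
    rw [abs_le] at hv ⊢
    constructor <;> nlinarith [pow_pos hh 2, pow_pos hh 3]
  calc _ ≤ _ := key
    _ ≤ 32 * 4 ^ 3 * h ^ 3 * Real.exp 5 := by gcongr
    _ = _ := by ring

lemma le_magicExponent {N : ℕ} {x : ℝ} (hx : 0 < x) (hNx : (N : ℝ) ^ 2 * x ≤ 1) :
    -((N : ℝ) ^ 5 * x ^ 2 / 4) ≤ magicExponent N x := by
  have : ∑ i ∈ Finset.range N, (-((N : ℝ) ^ 4 * x ^ 2 / 4)) ≤ magicExponent N x := by
    refine Finset.sum_le_sum fun i hi => ?_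
    have h := scaled_index_bounds (Finset.mem_range.1 hi) hx hNx
    have h1 := le_logSinc h.1.1 h.1.2
    have h2 := logSinc_le h.2.1 h.2.2
    have h3 : (((N : ℝ) ^ 2 - i) * x) ^ 2 ≤ ((N : ℝ) ^ 2 * x) ^ 2 := by
      have := h.1.1
      gcongr
      have : (0 : ℝ) ≤ i := Nat.cast_nonneg i
      linarith
    have h4 := sq_nonneg (((i : ℝ) + 1) * x)
    nlinarith
  refine le_trans (le_of_eq ?_) this
  simp
  ring

lemma norm_geom_sum_exp_le {N : ℕ} (hN : 2 ≤ N) {x : ℝ} (hx : 1 ≤ (N : ℝ) ^ 2 * x)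
    (hx' : x ≤ Real.pi / 2) :
    ‖∑ k ∈ Finset.Icc 1 (N ^ 2), Complex.exp (2 * x * Complex.I) ^ k‖ ≤ 19 / 20 * (N : ℝ) ^ 2 := by
  have hN2 : (2 : ℝ) ≤ N := by exact_mod_cast hN
  have hN4 : (4 : ℝ) ≤ (N : ℝ) ^ 2 := by nlinarith
  have hx0 : 0 < x := by
    by_contra h
    nlinarith
  have key := norm_geom_sum_exp_mul (N ^ 2) x
  set A := ‖∑ k ∈ Finset.Icc 1 (N ^ 2), Complex.exp (2 * x * Complex.I) ^ k‖
  have hA : 0 ≤ A := norm_nonneg _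
  have hsin : 0 < Real.sin x :=
    Real.sin_pos_of_pos_of_lt_pi hx0 (by linarith [Real.pi_pos])
  rw [abs_of_pos hsin] at key
  push_cast at key
  rcases le_or_gt x (1 / 2) with h | h
  · have h1 := abs_sin_le_mul one_pos le_rfl hx
    have hc := (abs_le.1 (Real.cos_bound (x := 1 / 2) (by norm_num [abs_of_pos]))).2
    norm_num [abs_of_pos] at hc
    have hs := Real.sin_gt_sub_cube hx0
    have hs2 : 15 / 16 * x < Real.sin x := by nlinarith [mul_pos hx0 hx0]
    rw [← key] at h1
    have h2 : A * (15 / 16 * x) ≤ (N : ℝ) ^ 2 * x * (89 / 100) := by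
      have : (N : ℝ) ^ 2 * x * Real.cos (1 / 2) ≤ (N : ℝ) ^ 2 * x * (89 / 100) := by
        gcongr; linarith
      nlinarith
    by_contra! h3
    nlinarith
  · have hs : Real.sin (1 / 2) ≤ Real.sin x :=
      Real.sin_le_sin_of_le_of_le_pi_div_two (by linarith [Real.pi_pos]) hx' h.le
    have hs2 := Real.sin_gt_sub_cube (x := 1 / 2) (by norm_num)
    have h1 := Real.abs_sin_le_one ((N : ℝ) ^ 2 * x)
    norm_num at hs hs2
    nlinarith

lemma abs_magicKernel_le_of_one_le {N : ℕ} (hN : 2 ≤ N) {x : ℝ} (hx : 1 ≤ (N : ℝ) ^ 2 * x)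
    (hx' : x ≤ Real.pi / 2) :
    |magicKernel N (2 * x)| ≤ (N : ℝ) ^ N * Real.exp (19 / 20 * N + 1 / 2) := by
  have hN0 : (0 : ℝ) < N := by exact_mod_cast (by omega : 0 < N)
  refine (abs_magicKernel_le _ _).trans ?_
  have hq : Complex.exp ((2 * x : ℝ) * Complex.I) = Complex.exp (2 * x * Complex.I) := by
    push_cast; rfl
  refine (norm_subsetSumGF_le (M := N ^ 2) (by nlinarith) (r := 1 / N) (by positivity)
    (Complex.norm_exp_ofReal_mul_I _)).trans ?_
  rw [hq]
  have h1 := norm_geom_sum_exp_le hN hx hx'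
  have e : ((1 / (N : ℝ)) ^ N)⁻¹ = (N : ℝ) ^ N := by simp
  rw [e]
  gcongr (N : ℝ) ^ N * Real.exp ?_
  calc _ ≤ 1 / (N : ℝ) * (19 / 20 * (N : ℝ) ^ 2) + ((N ^ 2 : ℕ) : ℝ) * (1 / (N : ℝ)) ^ 2 / 2 := by
        gcongr
    _ = _ := by push_cast; field_simp

lemma integral_sq_pow_mul_exp (k : ℕ) :
    ∫ t in Set.Ioi (0 : ℝ), (t ^ 2) ^ k * Real.exp (-(t ^ 2 / 24)) =
      √(6 * Real.pi) * (12 ^ k * (Nat.doubleFactorial (2 * k - 1) : ℕ)) := by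
  have h := integral_rpow_mul_exp_neg_mul_rpow (p := 2) (q := 2 * k) (b := 1 / 24) (by norm_num)
    (by have : (0 : ℝ) ≤ k := Nat.cast_nonneg k
        linarith) (by norm_num)
  have e (t : ℝ) : t ^ (2 * (k : ℝ)) * Real.exp (-(1 / 24) * t ^ (2 : ℝ)) =
      (t ^ 2) ^ k * Real.exp (-(t ^ 2 / 24)) := by
    have h1 : (2 * (k : ℝ)) = ((2 * k : ℕ) : ℝ) := by push_cast; ring
    rw [h1, Real.rpow_natCast, pow_mul, Real.rpow_two]
    congr 2
    ring
  simp only [e] at h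
  rw [h]
  have e2 : (2 * (k : ℝ) + 1) / 2 = k + 1 / 2 := by ring
  have e3 : -(2 * (k : ℝ) + 1) / 2 = -(k + 1 / 2) := by ring
  rw [e2, e3, Real.Gamma_nat_add_half, Real.rpow_neg (by norm_num), Real.rpow_add (by norm_num),
    Real.rpow_natCast, ← Real.sqrt_eq_rpow]
  have e4 : √(6 * Real.pi) = √6 * √Real.pi := Real.sqrt_mul (by norm_num) _
  have e5 : √(1 / 24 : ℝ) = (2 * √6)⁻¹ := by
    rw [Real.sqrt_eq_iff_mul_self_eq (by norm_num) (by positivity)]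
    rw [← mul_inv]
    rw [show 2 * √6 * (2 * √6) = 4 * (√6 * √6) by ring, Real.mul_self_sqrt (by norm_num)]
    norm_num
  have e6 : (24 : ℝ) ^ k = 12 ^ k * 2 ^ k := by rw [← mul_pow]; norm_num
  rw [e4, e5, div_pow, one_pow, mul_inv, inv_inv, one_div, inv_inv, e6]
  field_simp

lemma integrable_eval_mul_exp_neg_mul_sq (p : Polynomial ℝ) {b : ℝ} (hb : 0 < b) :
    MeasureTheory.Integrable fun t : ℝ => p.eval t * Real.exp (-b * t ^ 2) := by
  induction p using Polynomial.induction_on' with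
  | add p q hp hq =>
    simp only [Polynomial.eval_add, add_mul]
    exact hp.add hq
  | monomial n a =>
    have h := (integrable_rpow_mul_exp_neg_mul_sq hb (s := n)
      (by have : (0 : ℝ) ≤ n := Nat.cast_nonneg n
          linarith)).const_mul a
    simpa only [Polynomial.eval_monomial, Real.rpow_natCast, mul_assoc] using h

/-- The Gaussian, with its first two corrections, which approximates the rescaled kernel. -/
noncomputable def gaussianExpansion (h t : ℝ) : ℝ :=
  Real.exp (-(t ^ 2 / 24)) * (1 + (t ^ 2 / 24 - (t ^ 2) ^ 2 / 2880) * h +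
    ((t ^ 2 / 24 - (t ^ 2) ^ 2 / 2880) ^ 2 / 2 +
      (-(t ^ 2) / 24 + (t ^ 2) ^ 2 / 1440 - (t ^ 2) ^ 3 / 181440)) * h ^ 2)

lemma integrable_sq_pow_mul_exp (k : ℕ) :
    MeasureTheory.Integrable fun t : ℝ => (t ^ 2) ^ k * Real.exp (-(t ^ 2 / 24)) := by
  have h := integrable_eval_mul_exp_neg_mul_sq (Polynomial.X ^ (2 * k)) (b := 1 / 24) (by norm_num)
  refine h.congr (Eventually.of_forall fun t => ?_)
  simp only [Polynomial.eval_pow, Polynomial.eval_X, pow_mul]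
  congr 2
  ring

lemma gaussianExpansion_eq_sum (h t : ℝ) :
    gaussianExpansion h t = ∑ k ∈ Finset.range 5, ![1, h / 24 - h ^ 2 / 24,
      -(h / 2880) + h ^ 2 / 640, -(h ^ 2 * (29 / 1451520)), h ^ 2 / 16588800]
        (Fin.ofNat 5 k) * ((t ^ 2) ^ k * Real.exp (-(t ^ 2 / 24))) := by
  simp [Finset.sum_range_succ, Fin.ofNat, gaussianExpansion]
  ring

lemma integrable_gaussianExpansion (h : ℝ) : MeasureTheory.Integrable (gaussianExpansion h) := by
  rw [funext (gaussianExpansion_eq_sum h)]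
  exact MeasureTheory.integrable_finsetSum _ fun k _ => (integrable_sq_pow_mul_exp k).const_mul _

lemma integral_gaussianExpansion (h : ℝ) :
    ∫ t in Set.Ioi (0 : ℝ), gaussianExpansion h t =
      √(6 * Real.pi) * (1 + 7 / 20 * h + (-237 / 1120) * h ^ 2) := by
  rw [funext (gaussianExpansion_eq_sum h), MeasureTheory.integral_finsetSum _
    fun k _ => ((integrable_sq_pow_mul_exp k).const_mul _).integrableOn]
  simp only [MeasureTheory.integral_const_mul, integral_sq_pow_mul_exp]
  simp [Finset.sum_range_succ, Fin.ofNat, Nat.doubleFactorial]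
  ring

/-- A polynomial dominating the coefficients in the expansion of `magicExponent`. -/
def coeffBound (T : ℝ) : ℝ := 1 + T + T ^ 2 + T ^ 3 + T ^ 4

lemma abs_expansion_coeffs_le {T : ℝ} (hT : 0 ≤ T) :
    |T / 24 - T ^ 2 / 2880| ≤ coeffBound T ∧
      |-T / 24 + T ^ 2 / 1440 - T ^ 3 / 181440| ≤ coeffBound T := by
  have h2 := pow_nonneg hT 2
  have h3 := pow_nonneg hT 3
  have h4 := pow_nonneg hT 4
  unfold coeffBound
  constructor <;> rw [abs_le] <;> constructor <;> linarith

lemma abs_exp_magicExponent_sub_le {N : ℕ} (hN : 10 ≤ N) {x t : ℝ} (hx : 0 < x)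
    (hNx : (N : ℝ) ^ 2 * x ≤ 1) (ht : 4 * (N : ℝ) ^ 5 * x ^ 2 = t ^ 2) :
    |Real.exp (magicExponent N x) - gaussianExpansion (1 / N) t| ≤
      32 * (1 / (N : ℝ)) ^ 3 * (coeffBound (t ^ 2) ^ 3 * Real.exp (-(1 / 48) * t ^ 2)) := by
  have hN' : (10 : ℝ) ≤ N := by exact_mod_cast hN
  have hN0 : (0 : ℝ) < N := by linarith
  have hT : 0 ≤ t ^ 2 := sq_nonneg t
  have hl := le_magicExponent hx hNx
  have hu := magicExponent_le hN hx hNx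
  have hE := abs_magicExponent_add_le (by omega) hx hNx ht
  unfold gaussianExpansion
  set T := t ^ 2
  set E := magicExponent N x
  have hB : 1 ≤ coeffBound T := by
    have h2 := pow_nonneg hT 2
    have h3 := pow_nonneg hT 3
    have h4 := pow_nonneg hT 4
    unfold coeffBound
    linarith
  have hh : 0 < 1 / (N : ℝ) := by positivity
  have hh1 : 1 / (N : ℝ) ≤ 1 := by
    rw [div_le_one hN0]; linarith
  have hv : |(E + T / 24) - ((T / 24 - T ^ 2 / 2880) * (1 / N) +
      (-T / 24 + T ^ 2 / 1440 - T ^ 3 / 181440) * (1 / (N : ℝ)) ^ 2)| ≤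
      coeffBound T * (1 / (N : ℝ)) ^ 3 := by
    calc _ = |E + T / 24 - (T / 24 - T ^ 2 / 2880) / N -
          (-T / 24 + T ^ 2 / 1440 - T ^ 3 / 181440) / (N : ℝ) ^ 2| := by congr 1; ring
      _ ≤ (T + T ^ 2 + T ^ 3 + T ^ 4) / (N : ℝ) ^ 3 := hE
      _ = (T + T ^ 2 + T ^ 3 + T ^ 4) * (1 / (N : ℝ)) ^ 3 := by ring
      _ ≤ _ := by unfold coeffBound; gcongr; linarith
  have hcoef := abs_expansion_coeffs_le hT
  have key := abs_exp_sub_expansion_le hh hh1 hB hcoef.1 hcoef.2 hv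
  have hvT : |E + T / 24| ≤ T / 48 := by
    rw [abs_le]; constructor <;> linarith
  have e : Real.exp E = Real.exp (-(T / 24)) * Real.exp (E + T / 24) := by
    rw [← Real.exp_add]; congr 1; ring
  rw [e, ← mul_sub, abs_mul, Real.abs_exp]
  calc _ ≤ Real.exp (-(T / 24)) * (32 * coeffBound T ^ 3 * (1 / (N : ℝ)) ^ 3 *
        Real.exp (T / 48)) := by
        refine mul_le_mul_of_nonneg_left (key.trans ?_) (Real.exp_pos _).le
        have : 0 ≤ coeffBound T := by linarith
        gcongr
    _ = 32 * (1 / (N : ℝ)) ^ 3 * (coeffBound T ^ 3 *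
        (Real.exp (-(T / 24)) * Real.exp (T / 48))) := by ring
    _ = _ := by
      rw [← Real.exp_add]
      congr 3
      ring

lemma abs_gaussianExpansion_le {h t : ℝ} (hh : 0 < h) (hh1 : h ≤ 1) (ht : 1 ≤ t ^ 2 * h) :
    |gaussianExpansion h t| ≤
      32 * h ^ 3 * (coeffBound (t ^ 2) ^ 3 * Real.exp (-(1 / 48) * t ^ 2)) := by
  have hT : 0 ≤ t ^ 2 := sq_nonneg t
  unfold gaussianExpansion
  set T := t ^ 2
  have hcoef := abs_expansion_coeffs_le hT
  set u₁ := T / 24 - T ^ 2 / 2880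
  set u₂ := -T / 24 + T ^ 2 / 1440 - T ^ 3 / 181440
  have h2 := pow_nonneg hT 2
  have h4 := pow_nonneg hT 4
  have h3 := pow_nonneg hT 3
  have hB : 1 ≤ coeffBound T := by
    unfold coeffBound
    linarith
  have hB3 : T ^ 3 ≤ coeffBound T := by
    unfold coeffBound
    linarith
  set B := coeffBound T
  have hB0 : 0 ≤ B := by linarith
  have hT3 : 1 ≤ B * h ^ 3 := by
    calc (1 : ℝ) ≤ (T * h) ^ 3 := one_le_pow₀ ht
      _ = T ^ 3 * h ^ 3 := by ring
      _ ≤ B * h ^ 3 := by gcongr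
  have hB2 : B ≤ B ^ 2 := by nlinarith
  have hu : |1 + u₁ * h + (u₁ ^ 2 / 2 + u₂) * h ^ 2| ≤ 4 * B ^ 2 := by
    have a1 : |u₁ * h| ≤ B := by
      rw [abs_mul, abs_of_pos hh]
      nlinarith [abs_nonneg u₁]
    have a2 : u₁ ^ 2 ≤ B ^ 2 := by
      rw [← sq_abs]; exact pow_le_pow_left₀ (abs_nonneg _) hcoef.1 2
    have a3 : |u₁ ^ 2 / 2 + u₂| ≤ 2 * B ^ 2 := by
      have := abs_le.1 hcoef.2
      rw [abs_le]
      constructor <;> nlinarith [sq_nonneg u₁]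
    have a4 : |(u₁ ^ 2 / 2 + u₂) * h ^ 2| ≤ 2 * B ^ 2 := by
      rw [abs_mul, abs_of_pos (pow_pos hh 2)]
      have : h ^ 2 ≤ 1 := pow_le_one₀ hh.le hh1
      nlinarith [abs_nonneg (u₁ ^ 2 / 2 + u₂), pow_pos hh 2]
    rw [abs_le] at a1 a4 ⊢
    constructor <;> linarith [a1.1, a1.2, a4.1, a4.2]
  rw [abs_mul, Real.abs_exp]
  calc _ ≤ Real.exp (-(1 / 48) * T) * (4 * B ^ 2) := by
        gcongr
        linarith
    _ ≤ Real.exp (-(1 / 48) * T) * (4 * B ^ 2 * (B * h ^ 3)) :=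
        mul_le_mul_of_nonneg_left (le_mul_of_one_le_right (by positivity) hT3) (Real.exp_pos _).le
    _ = 4 * (h ^ 3 * (B ^ 3 * Real.exp (-(1 / 48) * T))) := by ring
    _ ≤ 32 * (h ^ 3 * (B ^ 3 * Real.exp (-(1 / 48) * T))) := by
        gcongr
        norm_num
    _ = _ := by ring

lemma integrable_coeffBound_pow_mul_exp :
    MeasureTheory.Integrable fun t : ℝ =>
      coeffBound (t ^ 2) ^ 3 * Real.exp (-(1 / 48) * t ^ 2) := by
  have h := integrable_eval_mul_exp_neg_mul_sq
    ((1 + Polynomial.X ^ 2 + (Polynomial.X ^ 2) ^ 2 + (Polynomial.X ^ 2) ^ 3 +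
      (Polynomial.X ^ 2) ^ 4) ^ 3) (b := 1 / 48) (by norm_num)
  simpa [coeffBound] using h

lemma abs_integral_magicKernel_sub_le {N : ℕ} (hN : 10 ≤ N) :
    |(∫ t in (0 : ℝ)..2 * √N, magicKernel N (t / ((N : ℝ) ^ 2 * √N))) -
        (∏ i ∈ Finset.range N, (((N : ℝ) ^ 2 - i) / (i + 1))) *
          (√(6 * Real.pi) * (1 + 7 / 20 * (1 / N) + (-237 / 1120) * (1 / (N : ℝ)) ^ 2))| ≤
      (∏ i ∈ Finset.range N, (((N : ℝ) ^ 2 - i) / (i + 1))) *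
        (32 * (∫ t in Set.Ioi (0 : ℝ), coeffBound (t ^ 2) ^ 3 * Real.exp (-(1 / 48) * t ^ 2)) *
          (1 / (N : ℝ)) ^ 3) := by
  have hN' : (10 : ℝ) ≤ N := by exact_mod_cast hN
  have hN0 : (0 : ℝ) < N := by linarith
  have hs : 0 < √(N : ℝ) := Real.sqrt_pos.2 hN0
  have hss : √(N : ℝ) ^ 2 = N := Real.sq_sqrt hN0.le
  have hC : 0 ≤ ∏ i ∈ Finset.range N, (((N : ℝ) ^ 2 - i) / (i + 1)) := by
    refine Finset.prod_nonneg fun i hi => ?_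
    have hi1 : (i : ℝ) ≤ N := by exact_mod_cast (Finset.mem_range.1 hi).le
    have : (i : ℝ) ≤ N ^ 2 := by nlinarith
    exact div_nonneg (by linarith) (by positivity)
  have hker := fun x (hx : 0 < x) (hNx : (N : ℝ) ^ 2 * x ≤ 1) => magicKernel_eq_mul_exp N hx hNx
  set C := ∏ i ∈ Finset.range N, (((N : ℝ) ^ 2 - i) / (i + 1))
  have hcont : Continuous fun t : ℝ => magicKernel N (t / ((N : ℝ) ^ 2 * √N)) :=
    (continuous_magicKernel N).comp (by fun_prop)
  rw [← integral_gaussianExpansion, intervalIntegral.integral_of_le (by positivity),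
    ← MeasureTheory.integral_const_mul C]
  have hsub : Set.Ioc (0 : ℝ) (2 * √N) ⊆ Set.Ioi 0 := fun t ht => ht.1
  have e1 : ∫ t in Set.Ioc (0 : ℝ) (2 * √N), magicKernel N (t / ((N : ℝ) ^ 2 * √N)) =
      ∫ t in Set.Ioi (0 : ℝ), (Set.Ioc (0 : ℝ) (2 * √N)).indicator
        (fun t => magicKernel N (t / ((N : ℝ) ^ 2 * √N))) t := by
    rw [MeasureTheory.setIntegral_indicator measurableSet_Ioc, Set.inter_eq_right.2 hsub]
  have hind : MeasureTheory.IntegrableOn ((Set.Ioc (0 : ℝ) (2 * √N)).indicator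
      (fun t => magicKernel N (t / ((N : ℝ) ^ 2 * √N)))) (Set.Ioi 0) := by
    refine MeasureTheory.Integrable.integrableOn ?_
    rw [MeasureTheory.integrable_indicator_iff measurableSet_Ioc]
    exact (hcont.integrableOn_Icc).mono_set Set.Ioc_subset_Icc_self
  rw [e1, ← MeasureTheory.integral_sub hind ((integrable_gaussianExpansion _).const_mul C).integrableOn]
  have e2 : C * (32 * (∫ t in Set.Ioi (0 : ℝ), coeffBound (t ^ 2) ^ 3 *
      Real.exp (-(1 / 48) * t ^ 2)) * (1 / (N : ℝ)) ^ 3) =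
      ∫ t in Set.Ioi (0 : ℝ), C * (32 * (1 / (N : ℝ)) ^ 3 *
        (coeffBound (t ^ 2) ^ 3 * Real.exp (-(1 / 48) * t ^ 2))) := by
    rw [MeasureTheory.integral_const_mul, MeasureTheory.integral_const_mul]
    ring
  rw [e2, ← Real.norm_eq_abs]
  refine MeasureTheory.norm_integral_le_of_norm_le
    ((integrable_coeffBound_pow_mul_exp.const_mul _).const_mul _).integrableOn ?_
  filter_upwards [MeasureTheory.ae_restrict_mem measurableSet_Ioi] with t ht
  have ht0 : 0 < t := ht
  rw [Real.norm_eq_abs]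
  rcases le_or_gt t (2 * √N) with h | h
  · rw [Set.indicator_of_mem (show t ∈ Set.Ioc (0 : ℝ) (2 * √N) from ⟨ht0, h⟩)]
    have hx : 0 < t / (2 * (N : ℝ) ^ 2 * √N) := by positivity
    have hNx : (N : ℝ) ^ 2 * (t / (2 * (N : ℝ) ^ 2 * √N)) ≤ 1 := by
      have : (N : ℝ) ^ 2 * (t / (2 * (N : ℝ) ^ 2 * √N)) = t / (2 * √N) := by field_simp
      rw [this, div_le_one (by positivity)]
      exact h
    have hT : 4 * (N : ℝ) ^ 5 * (t / (2 * (N : ℝ) ^ 2 * √N)) ^ 2 = t ^ 2 := by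
      rw [div_pow, mul_pow, hss]
      field_simp
      ring
    have e3 : t / ((N : ℝ) ^ 2 * √N) = 2 * (t / (2 * (N : ℝ) ^ 2 * √N)) := by
      field_simp
    rw [e3, hker _ hx hNx, ← mul_sub, abs_mul, abs_of_nonneg hC]
    exact mul_le_mul_of_nonneg_left (abs_exp_magicExponent_sub_le hN hx hNx hT) hC
  · rw [Set.indicator_of_notMem (fun h' => absurd h'.2 (not_le.2 h)), zero_sub, abs_neg, abs_mul,
      abs_of_nonneg hC]
    refine mul_le_mul_of_nonneg_left (abs_gaussianExpansion_le (by positivity) ?_ ?_) hC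
    · rw [div_le_one hN0]; linarith
    · rw [mul_one_div, le_div_iff₀ hN0]
      nlinarith

lemma pi_mul_magicSquareSeries_eq {N : ℕ} (hN : 0 < N) :
    Real.pi * magicSquareSeries N =
      ((N : ℝ) ^ 2 * √N)⁻¹ * (∫ t in (0 : ℝ)..2 * √N, magicKernel N (t / ((N : ℝ) ^ 2 * √N))) +
        ∫ θ in 2 / (N : ℝ) ^ 2..Real.pi, magicKernel N θ := by
  have hN0 : (0 : ℝ) < N := by exact_mod_cast hN
  have hs : 0 < √(N : ℝ) := Real.sqrt_pos.2 hN0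
  have hi := (continuous_magicKernel N).intervalIntegrable (μ := MeasureTheory.volume)
  rw [← integral_magicKernel, intervalIntegral.integral_comp_div _ (by positivity), smul_eq_mul,
    inv_mul_cancel_left₀ (by positivity), zero_div,
    show 2 * √N / ((N : ℝ) ^ 2 * √N) = 2 / (N : ℝ) ^ 2 by field_simp,
    intervalIntegral.integral_add_adjacent_intervals (hi _ _) (hi _ _)]

lemma abs_integral_magicKernel_tail_le {N : ℕ} (hN : 2 ≤ N) :
    |∫ θ in 2 / (N : ℝ) ^ 2..Real.pi, magicKernel N θ| ≤
      4 * ((N : ℝ) ^ N * Real.exp (19 / 20 * N + 1 / 2)) := by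
  have hN2 : (2 : ℝ) ≤ N := by exact_mod_cast hN
  have hN0 : (0 : ℝ) < N := by linarith
  have hle : 2 / (N : ℝ) ^ 2 ≤ Real.pi := by
    rw [div_le_iff₀ (by positivity)]
    nlinarith [Real.pi_gt_three]
  have h0 : 0 < 2 / (N : ℝ) ^ 2 := by positivity
  have h := intervalIntegral.norm_integral_le_of_norm_le_const (a := 2 / (N : ℝ) ^ 2)
    (b := Real.pi) (f := magicKernel N) (C := (N : ℝ) ^ N * Real.exp (19 / 20 * N + 1 / 2))
    fun θ hθ => by
      rw [Set.uIoc_of_le hle] at hθ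
      have e : θ = 2 * (θ / 2) := by ring
      rw [Real.norm_eq_abs, e]
      refine abs_magicKernel_le_of_one_le hN ?_ (by linarith [hθ.2])
      have := hθ.1
      rw [div_lt_iff₀ (by positivity)] at this
      linarith
  rw [Real.norm_eq_abs, abs_of_nonneg (sub_nonneg.2 hle)] at h
  refine h.trans ?_
  rw [mul_comm]
  gcongr
  linarith [Real.pi_lt_four]

lemma sqrt_mul_scale_eq {N : ℕ} (hN : 0 < N) :
    Real.sqrt (Real.exp 1 / 3) * (N : ℝ) ^ 3 * ((N : ℝ) ^ 2 * √N)⁻¹ * √(6 * Real.pi) =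
      √(2 * N) * √Real.pi * Real.exp (1 / 2) := by
  have hN0 : (0 : ℝ) < N := by exact_mod_cast hN
  have hs : 0 < √(N : ℝ) := Real.sqrt_pos.2 hN0
  have hss : √(N : ℝ) ^ 2 = N := Real.sq_sqrt hN0.le
  have h1 : Real.exp (1 / 2) = √(Real.exp 1) := Real.exp_half 1
  have h2 : √(6 * Real.pi) = √2 * √3 * √Real.pi := by
    rw [← Real.sqrt_mul (by norm_num), ← Real.sqrt_mul (by norm_num)]
    norm_num
  rw [h1, h2, Real.sqrt_div (Real.exp_pos 1).le, Real.sqrt_mul (by norm_num)]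
  field_simp
  linear_combination (-1 : ℝ) * hss

lemma pow_three_mul_exp_tail_le {N : ℕ} (hN : 0 < N) :
    (N : ℝ) ^ 3 * (((N : ℝ) * Real.exp 1) ^ N)⁻¹ *
        ((N : ℝ) ^ N * Real.exp (19 / 20 * N + 1 / 2)) ≤
      720 * 20 ^ 6 * Real.exp (1 / 2) * (1 / (N : ℝ)) ^ 3 := by
  have hN0 : (0 : ℝ) < N := by exact_mod_cast hN
  have h := Real.pow_div_factorial_le_exp (x := (N : ℝ) / 20) (by positivity) 6
  have e1 : Real.exp (19 / 20 * N + 1 / 2) =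
      Real.exp 1 ^ N * (Real.exp (N / 20))⁻¹ * Real.exp (1 / 2) := by
    rw [← Real.exp_nat_mul, ← Real.exp_neg, ← Real.exp_add, ← Real.exp_add]
    congr 1
    ring
  have e2 : (N : ℝ) ^ 3 * (((N : ℝ) * Real.exp 1) ^ N)⁻¹ *
        ((N : ℝ) ^ N * Real.exp (19 / 20 * N + 1 / 2)) =
      ((N : ℝ) ^ 6 * (Real.exp (N / 20))⁻¹) * (Real.exp (1 / 2) * (1 / (N : ℝ)) ^ 3) := by
    rw [e1, mul_pow]
    field_simp
  have h3 : (N : ℝ) ^ 6 * (Real.exp (N / 20))⁻¹ ≤ 720 * 20 ^ 6 := by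
    rw [← div_eq_mul_inv, div_le_iff₀ (Real.exp_pos _)]
    rw [div_pow] at h
    norm_num [Nat.factorial] at h ⊢
    linarith
  rw [e2]
  calc _ ≤ 720 * 20 ^ 6 * (Real.exp (1 / 2) * (1 / (N : ℝ)) ^ 3) := by gcongr
    _ = _ := by ring

lemma abs_mul_expansion_sub_le {h c K : ℝ} (hh : 0 < h) (hh1 : h ≤ 1)
    (hc : |c - (1 + 1 / 4 * h + 19 / 96 * h ^ 2)| ≤ K * h ^ 3) :
    |c * (1 + 7 / 20 * h + (-237 / 1120) * h ^ 2) - (1 + 3 / 5 * h + 31 / 420 * h ^ 2)| ≤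
      (2 * K + 1) * h ^ 3 := by
  have hh2 : h ^ 2 ≤ 1 := pow_le_one₀ hh.le hh1
  have hm : |1 + 7 / 20 * h + (-237 / 1120) * h ^ 2| ≤ 2 := by
    rw [abs_le]; constructor <;> nlinarith [pow_pos hh 2]
  have e : c * (1 + 7 / 20 * h + (-237 / 1120) * h ^ 2) - (1 + 3 / 5 * h + 31 / 420 * h ^ 2) =
      (c - (1 + 1 / 4 * h + 19 / 96 * h ^ 2)) * (1 + 7 / 20 * h + (-237 / 1120) * h ^ 2) +
        h ^ 3 * ((1 / 4) * (-237 / 1120) + 19 / 96 * (7 / 20) + 19 / 96 * (-237 / 1120) * h) := by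
    ring
  rw [e]
  refine (abs_add_le _ _).trans ?_
  have h1 : |(c - (1 + 1 / 4 * h + 19 / 96 * h ^ 2)) *
      (1 + 7 / 20 * h + (-237 / 1120) * h ^ 2)| ≤ K * h ^ 3 * 2 := by
    rw [abs_mul]
    exact mul_le_mul hc hm (abs_nonneg _) ((abs_nonneg _).trans hc)
  have h2 : |h ^ 3 * ((1 / 4) * (-237 / 1120) + 19 / 96 * (7 / 20) +
      19 / 96 * (-237 / 1120) * h)| ≤ h ^ 3 * 1 := by
    rw [abs_mul, abs_of_pos (pow_pos hh 3)]
    refine mul_le_mul_of_nonneg_left ?_ (pow_pos hh 3).le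
    rw [abs_le]
    constructor <;> linarith
  linarith

/-- Second-order asymptotic expansion for the number of magic square series:
`𝒩₂(N) = (1/π)√(3/e) (Ne)^N / N³ (1 + 3/(5N) + 31/(420N²) + O(1/N³))`, stated as
`π√(e/3) N³ (Ne)^{-N} 𝒩₂(N) - (1 + 3/(5N) + 31/(420N²)) = O(1/N³)`. -/
theorem magic_square_series_asymptotics :
    (fun N : ℕ =>
        Real.pi * Real.sqrt (Real.exp 1 / 3) * (N : ℝ) ^ 3 *
            (((N : ℝ) * Real.exp 1) ^ N)⁻¹ * (magicSquareSeries N : ℝ) -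
          (1 + 3 / (5 * (N : ℝ)) + 31 / (420 * (N : ℝ) ^ 2)))
      =O[atTop] fun N : ℕ => 1 / (N : ℝ) ^ 3 := by
  set J : ℝ := 32 * ∫ t in Set.Ioi (0 : ℝ), coeffBound (t ^ 2) ^ 3 * Real.exp (-(1 / 48) * t ^ 2)
    with hJ
  have hJ0 : 0 ≤ J := by
    refine mul_nonneg (by norm_num) (MeasureTheory.integral_nonneg fun t => ?_)
    have : 0 ≤ coeffBound (t ^ 2) := by unfold coeffBound; positivity
    positivity
  set K : ℝ := 2048 * Real.exp 5 with hK
  have hK0 : 0 ≤ K := by positivity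
  set L : ℝ := 720 * 20 ^ 6 * Real.exp (1 / 2) with hL
  refine IsBigO.of_bound ((2 * K + 1) + (K + 2) * J + √(Real.exp 1 / 3) * (4 * L)) ?_
  filter_upwards [eventually_ge_atTop 10] with N hN
  have hN' : (10 : ℝ) ≤ N := by exact_mod_cast hN
  have hN0 : (0 : ℝ) < N := by linarith
  have hs : 0 < √(N : ℝ) := Real.sqrt_pos.2 hN0
  have hmain := abs_integral_magicKernel_sub_le hN
  have hC := abs_prod_ratio_sub_le (N := N) (by omega)
  have htail := abs_integral_magicKernel_tail_le (N := N) (by omega)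
  have hscale := sqrt_mul_scale_eq (N := N) (by omega)
  have hexp := pow_three_mul_exp_tail_le (N := N) (by omega)
  have hpi := pi_mul_magicSquareSeries_eq (N := N) (by omega)
  rw [← hscale] at hC
  rw [← hJ] at hmain
  rw [← hK] at hC
  rw [← hL] at hexp
  set C := ∏ i ∈ Finset.range N, (((N : ℝ) ^ 2 - i) / (i + 1))
  set I := ∫ t in (0 : ℝ)..2 * √N, magicKernel N (t / ((N : ℝ) ^ 2 * √N))
  set R := ∫ θ in 2 / (N : ℝ) ^ 2..Real.pi, magicKernel N θ
  set W := (N : ℝ) ^ N * Real.exp (19 / 20 * N + 1 / 2)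
  set P := (((N : ℝ) * Real.exp 1) ^ N)⁻¹
  set A := √(Real.exp 1 / 3)
  set Q := ((N : ℝ) ^ 2 * √N)⁻¹
  have hQ : 0 < Q := by positivity
  have hP : 0 < P := by positivity
  have hA : 0 < A := by positivity
  have hsix : 1 ≤ √(6 * Real.pi) := by
    rw [Real.one_le_sqrt]
    linarith [Real.pi_gt_three]
  set h := 1 / (N : ℝ) with hh
  have hh0 : 0 < h := by positivity
  have hh1 : h ≤ 1 := by rw [hh, div_le_one hN0]; linarith
  have hh3 : 0 < h ^ 3 := pow_pos hh0 3
  set m := 1 + 7 / 20 * h + (-237 / 1120) * h ^ 2 with hm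
  set s := A * (N : ℝ) ^ 3 * Q * P
  have hs0 : 0 < s := by positivity
  set c := C * (A * (N : ℝ) ^ 3 * Q * √(6 * Real.pi)) * P with hc
  have hcs : c = s * C * √(6 * Real.pi) := by ring
  have hcK : c ≤ K + 2 := by
    have := (abs_le.1 hC).2
    have h2 : h ^ 2 ≤ 1 := pow_le_one₀ hh0.le hh1
    have h3 : h ^ 3 ≤ 1 := pow_le_one₀ hh0.le hh1
    nlinarith
  have hexpand := abs_mul_expansion_sub_le hh0 hh1 hC
  rw [← hm] at hexpand
  have hCn : 0 ≤ C * (J * h ^ 3) := (abs_nonneg _).trans hmain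
  have h1 : |s * (I - C * (√(6 * Real.pi) * m))| ≤ (K + 2) * J * h ^ 3 := by
    rw [abs_mul, abs_of_pos hs0]
    calc s * |I - C * (√(6 * Real.pi) * m)| ≤ s * (C * (J * h ^ 3)) := by gcongr
      _ ≤ s * (C * (J * h ^ 3)) * √(6 * Real.pi) :=
        le_mul_of_one_le_right (mul_nonneg hs0.le hCn) hsix
      _ = c * (J * h ^ 3) := by rw [hcs]; ring
      _ ≤ (K + 2) * (J * h ^ 3) := by gcongr
      _ = _ := by ring
  have h2 : |A * ((N : ℝ) ^ 3 * P * R)| ≤ A * (4 * L) * h ^ 3 := by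
    rw [abs_mul, abs_of_pos hA, abs_mul, abs_of_pos (by positivity : 0 < (N : ℝ) ^ 3 * P)]
    calc A * ((N : ℝ) ^ 3 * P * |R|) ≤ A * ((N : ℝ) ^ 3 * P * (4 * W)) := by gcongr
      _ = A * (4 * ((N : ℝ) ^ 3 * P * W)) := by ring
      _ ≤ A * (4 * (L * h ^ 3)) := by gcongr
      _ = _ := by ring
  have e : Real.pi * A * (N : ℝ) ^ 3 * P * (magicSquareSeries N : ℝ) -
      (1 + 3 / (5 * (N : ℝ)) + 31 / (420 * (N : ℝ) ^ 2)) =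
      (c * m - (1 + 3 / 5 * h + 31 / 420 * h ^ 2)) + s * (I - C * (√(6 * Real.pi) * m)) +
        A * ((N : ℝ) ^ 3 * P * R) := by
    have e1 : Real.pi * A * (N : ℝ) ^ 3 * P * (magicSquareSeries N : ℝ) =
        A * (N : ℝ) ^ 3 * P * (Real.pi * magicSquareSeries N) := by ring
    have e2 : 1 + 3 / (5 * (N : ℝ)) + 31 / (420 * (N : ℝ) ^ 2) =
        1 + 3 / 5 * h + 31 / 420 * h ^ 2 := by
      rw [hh]
      field_simp
    rw [e1, e2, hpi, hcs]
    ring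
  rw [e, Real.norm_eq_abs, Real.norm_eq_abs]
  have e3 : |1 / (N : ℝ) ^ 3| = h ^ 3 := by
    rw [abs_of_pos (by positivity), hh, one_div_pow]
  rw [e3]
  refine (abs_add_le _ _).trans ?_
  have h3 := abs_add_le (c * m - (1 + 3 / 5 * h + 31 / 420 * h ^ 2))
    (s * (I - C * (√(6 * Real.pi) * m)))
  linarith
end
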